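/- Consider the RGV ensemble of rate R, composition Q_X, distance function d and threshold Δ. Let ε > 0 and let 𝒟 be a fixed set of rational joint distributions contained in {P_{XX'} ∈ 𝒬(Q_X) : d(P_{XX'}) > Δ}. Assume that for some δ > 0 either condition (B) holds: min_{P∈𝒟} I_P(X;X') − 2δ ≤ R ≤ min{I_P(X;X') : P ∈ 𝒬(Q_X), d(P) ≤ Δ} − 2δ; or condition (C) holds: R ≤ min{ min_{P∈𝒟} I_P(X;X') − min_{P∈𝒬(Q_X): d(P)≤Δ} I_P(X;X'), min_{P∈𝒬(Q_X): d(P)≤Δ} I_P(X;X') } − 2δ. Then min_{P∈𝒟} P[N(P_{XX'}) ≤ e^{−nε}·E[N(P_{XX'})]] ≤̊ exp{ −min( e^{n(R−2δ)}, e^{n(2R − min_{P∈𝒟} I_P(X;X'))} ) }. -/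

import Mathlib

open Filter Finset
open scoped Classical

noncomputable section

namespace RGV

/-- A probability distribution on a finite type. -/
def IsDist {α : Type} [Fintype α] (p : α → ℝ) : Prop :=
  (∀ a, 0 ≤ p a) ∧ ∑ a, p a = 1

/-- `p` is an `n`-type: all probabilities are integer multiples of `1/n`. -/
def IsTypeDist {α : Type} (n : ℕ) (p : α → ℝ) : Prop :=
  ∀ a, ∃ k : ℕ, p a * n = k

/-- Empirical distribution of a sequence. -/
def emp {α : Type} [Fintype α] (n : ℕ) (x : Fin n → α) : α → ℝ :=
  fun a => ((Finset.univ.filter fun i => x i = a).card : ℝ) / n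

/-- Joint empirical distribution of a pair of sequences. -/
def emp2 {α β : Type} [Fintype α] [Fintype β] (n : ℕ) (x : Fin n → α) (y : Fin n → β) :
    α × β → ℝ :=
  fun ab => ((Finset.univ.filter fun i => x i = ab.1 ∧ y i = ab.2).card : ℝ) / n

/-- The type class of a composition `Q`. -/
def typeClass {α : Type} [Fintype α] (n : ℕ) (Q : α → ℝ) : Finset (Fin n → α) :=
  Finset.univ.filter fun x => emp n x = Q

/-- The pair type class of a joint type `P`. -/
def typeClass2 {α : Type} [Fintype α] (n : ℕ) (P : α × α → ℝ) :
    Finset ((Fin n → α) × (Fin n → α)) :=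
  Finset.univ.filter fun xx => emp2 n xx.1 xx.2 = P

/-- `P` is a joint distribution on `α × α` with both marginals equal to `Q`. -/
def Joint {α : Type} [Fintype α] (Q : α → ℝ) (P : α × α → ℝ) : Prop :=
  IsDist P ∧ (∀ a, ∑ b, P (a, b) = Q a) ∧ (∀ b, ∑ a, P (a, b) = Q b)

/-- `d` is a distance function: continuous and symmetric. -/
def IsDistance {α : Type} [Fintype α] (d : (α × α → ℝ) → ℝ) : Prop :=
  Continuous d ∧ ∀ P : α × α → ℝ, d (fun p => P (p.2, p.1)) = d P

/-- Mutual information of a joint distribution (natural logarithms). -/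
def mutInf {α β : Type} [Fintype α] [Fintype β] (P : α × β → ℝ) : ℝ :=
  ∑ p : α × β, P p * Real.log (P p / ((∑ b, P (p.1, b)) * (∑ a, P (a, p.2))))

/-- Positive part `[t]₊`. -/
def pos (t : ℝ) : ℝ := max t 0

/-- Number of codewords at blocklength `n` and rate `R`. -/
def Mof (R : ℝ) (n : ℕ) : ℕ := ⌈Real.exp (n * R)⌉₊

/-- The feasible set for the `i`-th codeword given the previous ones. -/
def feasible {α : Type} [Fintype α] (n : ℕ) (Q : α → ℝ) (d : (α × α → ℝ) → ℝ) (Δ : ℝ)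
    {M : ℕ} (c : Fin M → Fin n → α) (i : Fin M) : Finset (Fin n → α) :=
  (typeClass n Q).filter fun z => ∀ j, j < i → Δ < d (emp2 n z (c j))

/-- The probability that the RGV construction outputs the codebook `c`. -/
def rgvProb {α : Type} [Fintype α] (n : ℕ) (Q : α → ℝ) (d : (α × α → ℝ) → ℝ) (Δ : ℝ)
    {M : ℕ} (c : Fin M → Fin n → α) : ℝ :=
  ∏ i : Fin M,
    if c i ∈ feasible n Q d Δ c i then ((feasible n Q d Δ c i).card : ℝ)⁻¹ else 0

/-- Expectation over the RGV ensemble. -/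
def expect {α : Type} [Fintype α] (n : ℕ) (Q : α → ℝ) (d : (α × α → ℝ) → ℝ) (Δ : ℝ)
    (M : ℕ) (f : (Fin M → Fin n → α) → ℝ) : ℝ :=
  ∑ c : Fin M → Fin n → α, rgvProb n Q d Δ c * f c

/-- Probability of an event over the RGV ensemble. -/
def prob {α : Type} [Fintype α] (n : ℕ) (Q : α → ℝ) (d : (α × α → ℝ) → ℝ) (Δ : ℝ)
    (M : ℕ) (S : (Fin M → Fin n → α) → Prop) : ℝ :=
  ∑ c : Fin M → Fin n → α, if S c then rgvProb n Q d Δ c else 0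

/-- `W` is a (discrete memoryless) channel. -/
def IsChannel {α β : Type} [Fintype β] (W : α → β → ℝ) : Prop := ∀ a, IsDist (W a)

/-- The product (memoryless) extension of the channel. -/
def Wn {α β : Type} (n : ℕ) (W : α → β → ℝ) (x : Fin n → α) (y : Fin n → β) : ℝ :=
  ∏ i, W (x i) (y i)

/-- GLD error probability of a codebook. -/
def Pe {α β : Type} [Fintype α] [Fintype β] (n : ℕ) (W : α → β → ℝ)
    (g : (α × β → ℝ) → ℝ) {M : ℕ} (c : Fin M → Fin n → α) : ℝ :=
  (M : ℝ)⁻¹ * ∑ m : Fin M, ∑ m' ∈ Finset.univ.erase m, ∑ y : Fin n → β,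
    Wn n W (c m) y * Real.exp ((n : ℝ) * g (emp2 n (c m') y)) /
      ∑ m'' : Fin M, Real.exp ((n : ℝ) * g (emp2 n (c m'') y))

/-- Marginal `P_{XY}` induced by `P_{XX'}` and the conditional law `V = P_{Y|XX'}`. -/
def PXY {α β : Type} [Fintype α] [Fintype β] (P : α × α → ℝ) (V : α × α → β → ℝ) :
    α × β → ℝ :=
  fun ay => ∑ b, P (ay.1, b) * V (ay.1, b) ay.2

/-- Marginal `P_{X'Y}`. -/
def PXpY {α β : Type} [Fintype α] [Fintype β] (P : α × α → ℝ) (V : α × α → β → ℝ) :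
    α × β → ℝ :=
  fun bY => ∑ a, P (a, bY.1) * V (a, bY.1) bY.2

/-- Output marginal `P_Y`. -/
def PYof {α β : Type} [Fintype α] [Fintype β] (P : α × α → ℝ) (V : α × α → β → ℝ) :
    β → ℝ :=
  fun y => ∑ p : α × α, P p * V p y

/-- Conditional divergence `D(P_{Y|X} ‖ W | Q)`. -/
def condDiv {α β : Type} [Fintype α] [Fintype β] (Q : α → ℝ) (W : α → β → ℝ)
    (P : α × α → ℝ) (V : α × α → β → ℝ) : ℝ :=
  ∑ a, ∑ y, PXY P V (a, y) * Real.log (PXY P V (a, y) / (Q a * W a y))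

/-- Conditional mutual information `I(X';Y|X)`. -/
def cmi {α β : Type} [Fintype α] [Fintype β] (P : α × α → ℝ) (V : α × α → β → ℝ) : ℝ :=
  ∑ a, ∑ b, ∑ y, P (a, b) * V (a, b) y *
    Real.log (P (a, b) * V (a, b) y * (∑ b', P (a, b')) /
      (P (a, b) * PXY P V (a, y)))

/-- The joint distribution on `α × β` induced by `P_Y` and a reverse channel `V'`. -/
def jointOf {α β : Type} (PY : β → ℝ) (V' : β → α → ℝ) : α × β → ℝ :=
  fun ay => PY ay.2 * V' ay.2 ay.1

/-- The quantity `α(R, P_Y)`. -/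
def alphaF {α β : Type} [Fintype α] [Fintype β] (Q : α → ℝ) (g : (α × β → ℝ) → ℝ)
    (R : ℝ) (PY : β → ℝ) : ℝ :=
  sSup { v | ∃ V' : β → α → ℝ, (∀ y, IsDist (V' y)) ∧
    (∀ a, ∑ y, PY y * V' y a = Q a) ∧ mutInf (jointOf PY V') ≤ R ∧
    v = g (jointOf PY V') - mutInf (jointOf PY V') } + R

/-- The exponent `Γ(P_{XX'}, R)`. -/
def Gamma {α β : Type} [Fintype α] [Fintype β] (Q : α → ℝ) (W : α → β → ℝ)
    (g : (α × β → ℝ) → ℝ) (P : α × α → ℝ) (R : ℝ) : ℝ :=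
  sInf { v | ∃ V : α × α → β → ℝ, (∀ p, IsDist (V p)) ∧
    v = condDiv Q W P V + cmi P V +
      pos (max (g (PXY P V)) (alphaF Q g R (PYof P V)) - g (PXpY P V)) }

/-- The quantity `β(R, P_Y)`. -/
def betaF {α β : Type} [Fintype α] [Fintype β] (Q : α → ℝ) (g : (α × β → ℝ) → ℝ)
    (R : ℝ) (PY : β → ℝ) : ℝ :=
  sSup { v | ∃ V' : β → α → ℝ, (∀ y, IsDist (V' y)) ∧
    (∀ a, ∑ y, PY y * V' y a = Q a) ∧
    v = g (jointOf PY V') + pos (R - mutInf (jointOf PY V')) }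

/-- The exponent `Λ(P_{XX'}, R)`. -/
def Lambda {α β : Type} [Fintype α] [Fintype β] (Q : α → ℝ) (W : α → β → ℝ)
    (g : (α × β → ℝ) → ℝ) (P : α × α → ℝ) (R : ℝ) : ℝ :=
  sInf { v | ∃ V : α × α → β → ℝ, (∀ p, IsDist (V p)) ∧
    v = condDiv Q W P V + cmi P V + betaF Q g R (PYof P V) - g (PXpY P V) }

/-- The candidate value of the typical random coding exponent of the RGV ensemble. -/
def EtrcVal {α β : Type} [Fintype α] [Fintype β] (Q : α → ℝ) (W : α → β → ℝ)
    (g : (α × β → ℝ) → ℝ) (d : (α × α → ℝ) → ℝ) (Δ R : ℝ) : ℝ :=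
  sInf { v | ∃ P : α × α → ℝ, Joint Q P ∧ mutInf P ≤ 2 * R ∧ Δ < d P ∧
    v = Gamma Q W g P R + mutInf P - R }

/-- The expurgated exponent. -/
def Eex {α β : Type} [Fintype α] [Fintype β] (Q : α → ℝ) (W : α → β → ℝ)
    (g : (α × β → ℝ) → ℝ) (R : ℝ) : ℝ :=
  sInf { v | ∃ P : α × α → ℝ, Joint Q P ∧ mutInf P ≤ R ∧
    v = Gamma Q W g P R + mutInf P - R }

/-- The expurgated exponent of the RGV ensemble. -/
def EexRgv {α β : Type} [Fintype α] [Fintype β] (Q : α → ℝ) (W : α → β → ℝ)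
    (g : (α × β → ℝ) → ℝ) (d : (α × α → ℝ) → ℝ) (Δ R : ℝ) : ℝ :=
  sInf { v | ∃ P : α × α → ℝ, Joint Q P ∧ Δ < d P ∧ mutInf P ≤ R ∧
    v = Gamma Q W g P R + mutInf P - R }

/-- The rate condition at blocklength `n` with parameter `δ`
(the minimum over an empty collection of joint types being `+∞`). -/
def RateCond {α : Type} [Fintype α] (n : ℕ) (Q : α → ℝ) (d : (α × α → ℝ) → ℝ)
    (Δ R δ : ℝ) : Prop :=
  ((R : ℝ) : EReal) ≤
    sInf { v : EReal | ∃ P : α × α → ℝ, Joint Q P ∧ IsTypeDist n P ∧ d P ≤ Δ ∧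
      v = ((mutInf P : ℝ) : EReal) } - (((2 * δ : ℝ)) : EReal)

/-- Type enumerator: the number of ordered pairs of distinct codewords
with joint empirical distribution `P`. -/
def Nenum {α : Type} [Fintype α] (n : ℕ) (P : α × α → ℝ) {M : ℕ}
    (c : Fin M → Fin n → α) : ℕ :=
  ((Finset.univ : Finset (Fin M × Fin M)).filter fun mm =>
    mm.1 ≠ mm.2 ∧ emp2 n (c mm.1) (c mm.2) = P).card

/-- Normalized log of a probability (exponential rate), valued in `EReal`. -/
def lrate (n : ℕ) (p : ℝ) : EReal :=
  if p ≤ 0 then ⊥ else ((Real.log p / n : ℝ) : EReal)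

/-- Normalized iterated-log rate (double-exponential decay rate), valued in `EReal`. -/
def drate (n : ℕ) (p : ℝ) : EReal :=
  if p ≤ 0 then ⊤ else if 1 ≤ p then ⊥
  else ((Real.log (-Real.log p) / n : ℝ) : EReal)

/-- `δ_n = e^{-nδ}/(1-e^{-nδ})`. -/
def deltan (n : ℕ) (δ : ℝ) : ℝ := Real.exp (-(n * δ)) / (1 - Real.exp (-(n * δ)))


/-- Blocklength sequence: the multiples of the denominator `D` of the composition. -/
def nseq (D t : ℕ) : ℕ := D * (t + 1)

/-- The normalized expected log error probability `-(1/n) E[log P_e(C_n)]`. -/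
def Expnt {α β : Type} [Fintype α] [Fintype β] (n : ℕ) (Q : α → ℝ)
    (d : (α × α → ℝ) → ℝ) (Δ : ℝ) (W : α → β → ℝ) (g : (α × β → ℝ) → ℝ) (R : ℝ) : ℝ :=
  -(expect n Q d Δ (Mof R n) (fun c => Real.log (Pe n W g c)) / n)

/-- Ratio of type class sizes `|T(P)| / |T(Q)|²`. -/
def Lsize {α : Type} [Fintype α] (n : ℕ) (Q : α → ℝ) (P : α × α → ℝ) : ℝ :=
  ((typeClass2 n P).card : ℝ) / ((typeClass n Q).card : ℝ) ^ 2

end RGV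

namespace RGV

section Greedy

variable {S : Type} {M : ℕ}

/-- The number of codewords of index below `i` that are `A`-related to `y`. -/
def cover (A : S → S → Prop) (c : Fin M → S) (i : ℕ) (y : S) : ℕ :=
  (univ.filter fun j : Fin M => (j : ℕ) < i ∧ A (c j) y).card

/-- The number of ordered pairs of distinct indices with `A`-related codewords. -/
def pairCount (A : S → S → Prop) (c : Fin M → S) : ℕ :=
  ((univ : Finset (Fin M × Fin M)).filter fun mm => mm.1 ≠ mm.2 ∧ A (c mm.1) (c mm.2)).card

lemma cover_congr {A : S → S → Prop} {c c' : Fin M → S} {i : ℕ}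
    (h : ∀ j : Fin M, (j : ℕ) < i → c j = c' j) (y : S) : cover A c i y = cover A c' i y := by
  unfold cover
  congr 1
  refine filter_congr fun j _ => and_congr_right fun hj => ?_
  rw [h j hj]

lemma cover_succ (A : S → S → Prop) (c : Fin M → S) (i : Fin M) (y : S) :
    cover A c (i + 1) y = cover A c i y + if A (c i) y then 1 else 0 := by
  unfold cover
  split_ifs with h
  · rw [← card_insert_of_notMem (a := i) (by simp)]
    congr 1
    ext j
    simp only [mem_filter, mem_univ, true_and, mem_insert, Nat.lt_succ_iff_lt_or_eq, ← Fin.ext_iff]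
    constructor
    · rintro ⟨hj | hj, h'⟩
      · exact Or.inr ⟨hj, h'⟩
      · exact Or.inl hj
    · rintro (rfl | ⟨hj, h'⟩)
      · exact ⟨Or.inr rfl, h⟩
      · exact ⟨Or.inl hj, h'⟩
  · rw [add_zero]
    congr 1
    ext j
    simp only [mem_filter, mem_univ, true_and, Nat.lt_succ_iff_lt_or_eq, ← Fin.ext_iff]
    constructor
    · rintro ⟨hj | rfl, h'⟩
      · exact ⟨hj, h'⟩
      · exact absurd h' h
    · exact fun ⟨hj, h'⟩ => ⟨Or.inl hj, h'⟩

lemma sum_min_cover_le (A : S → S → Prop) (L : ℕ) (c : Fin M → S) :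
    ∑ i : Fin M, min (cover A c i (c i)) L ≤ pairCount A c := by
  calc ∑ i : Fin M, min (cover A c i (c i)) L
      ≤ ∑ i : Fin M, (univ.filter fun j : Fin M => j ≠ i ∧ A (c j) (c i)).card := by
        refine sum_le_sum fun i _ => (min_le_left _ _).trans (card_le_card fun j => ?_)
        simp only [mem_filter, mem_univ, true_and]
        exact fun ⟨h, h'⟩ => ⟨by rintro rfl; exact lt_irrefl _ h, h'⟩
    _ = pairCount A c := by
        rw [pairCount, card_filter, Fintype.sum_prod_type_right]
        exact sum_congr rfl fun i _ => card_filter _ _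

variable [Fintype S]

/-- The points in conflict with none of the codewords of index below `i`. -/
def feas (B : S → S → Prop) (c : Fin M → S) (i : ℕ) : Finset S :=
  univ.filter fun z => ∀ j : Fin M, (j : ℕ) < i → ¬ B z (c j)

/-- The probability of a codebook under sequential uniform conflict-free selection. -/
def weight (B : S → S → Prop) (c : Fin M → S) : ℝ :=
  ∏ i : Fin M, if c i ∈ feas B c i then ((feas B c i).card : ℝ)⁻¹ else 0

/-- Expectation under sequential uniform conflict-free selection. -/
def mean (B : S → S → Prop) (F : (Fin M → S) → ℝ) : ℝ := ∑ c, weight B c * F c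

/-- The total truncated cover of the feasible points. -/
def potential (A B : S → S → Prop) (L : ℕ) (c : Fin M → S) (i : ℕ) : ℕ :=
  ∑ y ∈ feas B c i, min (cover A c i y) L

/-- The increase of the potential caused by choosing `x` as the `i`-th codeword. -/
def gain (A B : S → S → Prop) (L : ℕ) (c : Fin M → S) (i : ℕ) (x : S) : ℕ :=
  ((feas B c i).filter fun y => A x y ∧ cover A c i y < L).card

/-- The decrease of the potential caused by choosing `x` as the `i`-th codeword. -/
def loss (A B : S → S → Prop) (L : ℕ) (c : Fin M → S) (i : ℕ) (x : S) : ℕ :=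
  ∑ y ∈ (feas B c i).filter (fun y => B y x), min (cover A c i y) L

lemma feas_congr {B : S → S → Prop} {c c' : Fin M → S} {i : ℕ}
    (h : ∀ j : Fin M, (j : ℕ) < i → c j = c' j) : feas B c i = feas B c' i := by
  unfold feas
  refine filter_congr fun z _ => forall_congr' fun j => ?_
  exact ⟨fun H hj => h j hj ▸ H hj, fun H hj => (h j hj).symm ▸ H hj⟩

lemma potential_congr {A B : S → S → Prop} {L : ℕ} {c c' : Fin M → S} {i : ℕ}
    (h : ∀ j : Fin M, (j : ℕ) < i → c j = c' j) :
    potential A B L c i = potential A B L c' i := by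
  simp only [potential, feas_congr h, cover_congr h]

lemma gain_congr {A B : S → S → Prop} {L : ℕ} {c c' : Fin M → S} {i : ℕ}
    (h : ∀ j : Fin M, (j : ℕ) < i → c j = c' j) (x : S) :
    gain A B L c i x = gain A B L c' i x := by
  simp only [gain, feas_congr h, cover_congr h]

lemma loss_congr {A B : S → S → Prop} {L : ℕ} {c c' : Fin M → S} {i : ℕ}
    (h : ∀ j : Fin M, (j : ℕ) < i → c j = c' j) (x : S) :
    loss A B L c i x = loss A B L c' i x := by
  simp only [loss, feas_congr h, cover_congr h]

lemma weight_nonneg (B : S → S → Prop) (c : Fin M → S) : 0 ≤ weight B c :=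
  prod_nonneg fun i _ => by split_ifs <;> positivity

lemma mean_mono {B : S → S → Prop} {F G : (Fin M → S) → ℝ} (h : ∀ c, F c ≤ G c) :
    mean B F ≤ mean B G :=
  sum_le_sum fun c _ => mul_le_mul_of_nonneg_left (h c) (weight_nonneg B c)

lemma mean_add (B : S → S → Prop) (F G : (Fin M → S) → ℝ) :
    mean B (fun c => F c + G c) = mean B F + mean B G := by
  simp only [mean, mul_add, sum_add_distrib]

lemma mean_const_mul (B : S → S → Prop) (r : ℝ) (F : (Fin M → S) → ℝ) :
    mean B (fun c => r * F c) = r * mean B F := by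
  simp only [mean, mul_sum]
  exact sum_congr rfl fun c _ => by ring

lemma mean_sum {ι : Type*} (B : S → S → Prop) (s : Finset ι) (F : ι → (Fin M → S) → ℝ) :
    mean B (fun c => ∑ i ∈ s, F i c) = ∑ i ∈ s, mean B (F i) := by
  simp only [mean, mul_sum]
  exact sum_comm

/-- A sum of products of adapted factors is at most the product of bounds on the
one-step sums. -/
lemma sum_prod_le_of_adapted [Nonempty S] : ∀ {M : ℕ} (f : (Fin M → S) → Fin M → ℝ)
    (r : Fin M → ℝ), (∀ c i, 0 ≤ f c i) →
    (∀ c c' i, (∀ j, j ≤ i → c j = c' j) → f c i = f c' i) →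
    (∀ c i, ∑ x, f (Function.update c i x) i ≤ r i) →
    ∑ c, ∏ i, f c i ≤ ∏ i, r i := by
  intro M
  induction M with
  | zero => intro f r _ _ _; simp
  | succ M ih =>
    intro f r hf0 hfc hfr
    obtain ⟨s⟩ := ‹Nonempty S›
    have hr : ∀ i, 0 ≤ r i := fun i => (sum_nonneg fun x _ => hf0 _ _).trans (hfr (fun _ => s) i)
    rw [← (Fin.consEquiv fun _ : Fin (M + 1) => S).sum_comp, Fintype.sum_prod_type,
      Fin.prod_univ_succ]
    calc ∑ x : S, ∑ c : Fin M → S, ∏ i, f (Fin.cons x c : Fin (M + 1) → S) i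
        = ∑ x : S, f (Function.update (fun _ => s) 0 x) 0 *
            ∑ c : Fin M → S, ∏ i : Fin M, f (Fin.cons x c : Fin (M + 1) → S) i.succ := by
          refine sum_congr rfl fun x _ => ?_
          rw [mul_sum]
          refine sum_congr rfl fun c _ => ?_
          rw [Fin.prod_univ_succ]
          congr 1
          refine hfc _ _ _ fun j hj => ?_
          obtain rfl : j = 0 := Fin.le_zero_iff.mp hj
          simp
      _ ≤ ∑ x : S, f (Function.update (fun _ => s) 0 x) 0 * ∏ i : Fin M, r i.succ := by
          refine sum_le_sum fun x _ => mul_le_mul_of_nonneg_left ?_ (hf0 _ _)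
          refine ih (fun c i => f (Fin.cons x c : Fin (M + 1) → S) i.succ) (fun i => r i.succ)
            (fun c i => hf0 _ _) (fun c c' i h => hfc _ _ _ fun j hj => ?_) fun c i => ?_
          · refine Fin.cases ?_ (fun k hk => ?_) j hj
            · intro _; simp
            · simpa using h k (Fin.succ_le_succ_iff.mp hk)
          · simp only [Fin.cons_update]
            exact hfr _ _
      _ ≤ r 0 * ∏ i : Fin M, r i.succ := by
          rw [← sum_mul]
          exact mul_le_mul_of_nonneg_right (hfr _ _) (prod_nonneg fun i _ => hr _)

/-- Product bound for expectations of adapted factors. -/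
lemma mean_prod_le [Nonempty S] {B : S → S → Prop} (g : (Fin M → S) → Fin M → S → ℝ)
    (r : Fin M → ℝ) (hg0 : ∀ c i x, 0 ≤ g c i x)
    (hgc : ∀ c c', ∀ i : Fin M, ∀ x, (∀ j : Fin M, (j : ℕ) < i → c j = c' j) →
      g c i x = g c' i x)
    (hne : ∀ c : Fin M → S, ∀ i : Fin M, (feas B c i).Nonempty)
    (hgr : ∀ c, ∀ i : Fin M, ∑ x ∈ feas B c i, g c i x ≤ r i * (feas B c i).card) :
    mean B (fun c => ∏ i, g c i (c i)) ≤ ∏ i, r i := by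
  unfold mean weight
  simp only [← prod_mul_distrib]
  refine sum_prod_le_of_adapted
    (fun c i => (if c i ∈ feas B c i then ((feas B c i).card : ℝ)⁻¹ else 0) * g c i (c i)) r
    (fun c i => mul_nonneg (by split_ifs <;> positivity) (hg0 _ _ _)) ?_ ?_
  · intro c c' i h
    have h' : ∀ j : Fin M, (j : ℕ) < i → c j = c' j := fun j hj => h j (le_of_lt hj)
    simp only [h i le_rfl, feas_congr h', hgc c c' i _ h']
  · intro c i
    have h' : ∀ x, ∀ j : Fin M, (j : ℕ) < i → Function.update c i x j = c j := fun x j hj =>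
      Function.update_of_ne (by rintro rfl; exact lt_irrefl _ hj) _ _
    simp only [feas_congr (h' _), Function.update_self, fun x => hgc _ c i x (h' x), ite_mul,
      zero_mul]
    rw [← sum_filter, filter_mem_eq_inter, univ_inter, ← mul_sum]
    have hpos : (0 : ℝ) < (feas B c i).card := by exact_mod_cast (hne c i).card_pos
    rw [inv_mul_le_iff₀ hpos, mul_comm]
    exact hgr c i

/-- One-step bound for the expectation of an adapted function. -/
lemma mean_single_le [Nonempty S] {B : S → S → Prop} (g : (Fin M → S) → S → ℝ) (k : Fin M)
    (r : ℝ) (hg0 : ∀ c x, 0 ≤ g c x)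
    (hgc : ∀ c c' x, (∀ j : Fin M, (j : ℕ) < k → c j = c' j) → g c x = g c' x)
    (hne : ∀ c : Fin M → S, ∀ i : Fin M, (feas B c i).Nonempty)
    (hgr : ∀ c, ∑ x ∈ feas B c k, g c x ≤ r * (feas B c k).card) :
    mean B (fun c => g c (c k)) ≤ r := by
  have := mean_prod_le (B := B) (fun c i x => if i = k then g c x else 1)
    (fun i => if i = k then r else 1) (fun c i x => by split_ifs; exacts [hg0 _ _, zero_le_one])
    (fun c c' i x h => by
      split_ifs with hi
      · subst hi; exact hgc c c' x h
      · rfl) hne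
    (fun c i => by
      split_ifs with hi
      · subst hi; exact hgr c
      · simp)
  simpa using this

lemma feas_succ (B : S → S → Prop) (c : Fin M → S) (i : Fin M) :
    feas B c (i + 1) = (feas B c i).filter fun y => ¬ B y (c i) := by
  ext z
  simp only [feas, mem_filter, mem_univ, true_and]
  constructor
  · exact fun h => ⟨fun j hj => h j (by omega), h i (by omega)⟩
  · rintro ⟨h, h'⟩ j hj
    rcases Nat.lt_succ_iff_lt_or_eq.mp hj with hj | hj
    · exact h j hj
    · rwa [Fin.ext hj]

lemma potential_succ {A B : S → S → Prop} (hAB : ∀ x y, A x y → ¬ B y x) (L : ℕ)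
    (c : Fin M → S) (i : Fin M) :
    potential A B L c (i + 1) + loss A B L c i (c i) =
      potential A B L c i + gain A B L c i (c i) := by
  have hmin : ∀ y, min (cover A c (i + 1) y) L =
      min (cover A c i y) L + if A (c i) y ∧ cover A c i y < L then 1 else 0 := by
    intro y
    rw [cover_succ]
    by_cases hA : A (c i) y <;> by_cases hL : cover A c i y < L <;> simp [hA, hL] <;> omega
  have hgain : gain A B L c i (c i) =
      ∑ y ∈ (feas B c i).filter (fun y => ¬ B y (c i)),
        if A (c i) y ∧ cover A c i y < L then 1 else 0 := by
    rw [gain, card_filter, sum_filter]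
    refine sum_congr rfl fun y _ => ?_
    by_cases hA : A (c i) y <;> simp [hA, hAB]
  rw [hgain, potential, feas_succ, loss, potential]
  simp only [hmin]
  rw [sum_add_distrib, ← sum_filter_add_sum_filter_not (feas B c i) (fun y => B y (c i))]
  ring

lemma potential_add_sum_loss {A B : S → S → Prop} (hAB : ∀ x y, A x y → ¬ B y x) (L : ℕ)
    (c : Fin M → S) {k : ℕ} (hk : k ≤ M) :
    potential A B L c k + ∑ i ∈ univ.filter (fun i : Fin M => (i : ℕ) < k), loss A B L c i (c i) =
      ∑ i ∈ univ.filter (fun i : Fin M => (i : ℕ) < k), gain A B L c i (c i) := by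
  induction k with
  | zero => simp [potential, cover]
  | succ k ih =>
    have hins : univ.filter (fun i : Fin M => (i : ℕ) < k + 1) =
        insert ⟨k, hk⟩ (univ.filter fun i : Fin M => (i : ℕ) < k) := by
      ext i
      simp only [mem_filter, mem_univ, true_and, mem_insert, Fin.ext_iff]
      omega
    have hs := potential_succ hAB L c ⟨k, hk⟩
    rw [hins, sum_insert (by simp), sum_insert (by simp)]
    have := ih (by omega)
    dsimp only at hs ⊢
    omega

end Greedy

section Concentration

variable {S : Type} [Fintype S] {M : ℕ}

/-- `A` is an `a`-regular relation disjoint from the symmetric conflict relation `B`, whose degrees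
are small compared with `card S / M`, and `L` is a truncation level exceeding the average cover. -/
structure Regular (A B : S → S → Prop) (a M L : ℕ) : Prop where
  card_out : ∀ x, (univ.filter fun y => A x y).card = a
  card_in : ∀ y, (univ.filter fun x => A x y).card = a
  disj : ∀ x y, A x y → ¬ B y x
  symm : ∀ x y, B x y → B y x
  card_conflict : ∀ x, 512 * M * (univ.filter fun z => B z x).card ≤ Fintype.card S
  trunc : 16 * M * a ≤ L * Fintype.card S
  trunc_pos : 0 < L
  deg_pos : 0 < a
  size : 2 ≤ M
  card_pos : 0 < Fintype.card S

variable {A B : S → S → Prop} {a L : ℕ}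

lemma Regular.nonempty (h : Regular A B a M L) : Nonempty S := Fintype.card_pos_iff.mp h.card_pos

lemma Regular.card_compl_feas (h : Regular A B a M L) (c : Fin M → S) (i : ℕ) :
    512 * (feas B c i)ᶜ.card ≤ Fintype.card S := by
  have hsub : (feas B c i)ᶜ ⊆ univ.biUnion fun j : Fin M => univ.filter fun z => B z (c j) := by
    intro z
    simp only [feas, mem_compl, mem_filter, mem_univ, true_and, mem_biUnion, not_forall, not_not]
    exact fun ⟨j, _, hj⟩ => ⟨j, hj⟩
  have hM : 0 < M := by have := h.size; omega
  refine Nat.le_of_mul_le_mul_left ?_ hM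
  calc M * (512 * (feas B c i)ᶜ.card)
      ≤ M * (512 * ∑ j : Fin M, (univ.filter fun z => B z (c j)).card) := by
        gcongr
        exact (card_le_card hsub).trans card_biUnion_le
    _ = ∑ j : Fin M, 512 * M * (univ.filter fun z => B z (c j)).card := by
        rw [← mul_assoc, mul_sum, mul_comm M]
    _ ≤ ∑ _j : Fin M, Fintype.card S := sum_le_sum fun j _ => h.card_conflict _
    _ = M * Fintype.card S := by simp

lemma Regular.card_feas (h : Regular A B a M L) (c : Fin M → S) (i : ℕ) :
    511 * Fintype.card S ≤ 512 * (feas B c i).card := by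
  have h1 := h.card_compl_feas c i
  have h2 := card_add_card_compl (feas B c i)
  omega

lemma Regular.feas_nonempty (h : Regular A B a M L) (c : Fin M → S) (i : ℕ) :
    (feas B c i).Nonempty := by
  rw [← Finset.card_pos]
  have h1 := h.card_feas c i
  have h2 := h.card_pos
  omega

lemma Regular.sum_cover_le (h : Regular A B a M L) (c : Fin M → S) (i : ℕ) :
    ∑ y, cover A c i y ≤ M * a := by
  unfold cover
  calc ∑ y : S, (univ.filter fun j : Fin M => (j : ℕ) < i ∧ A (c j) y).card
      ≤ ∑ y : S, (univ.filter fun j : Fin M => A (c j) y).card :=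
        sum_le_sum fun y _ => card_le_card fun j => by simp
    _ = ∑ j : Fin M, (univ.filter fun y : S => A (c j) y).card :=
        (sum_card_bipartiteAbove_eq_sum_card_bipartiteBelow
          (s := (univ : Finset (Fin M))) (t := (univ : Finset S)) fun j y => A (c j) y).symm
    _ = M * a := by simp [h.card_out]

lemma Regular.sum_gain (h : Regular A B a M L) (c : Fin M → S) (i : ℕ) :
    a * (feas B c i).card ≤ 2 * ∑ x ∈ feas B c i, gain A B L c i x := by
  set F := feas B c i with hF
  set G := F.filter fun y => cover A c i y < L with hG
  have hcompl : 512 * Fᶜ.card ≤ Fintype.card S := h.card_compl_feas c i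
  have htot := card_add_card_compl F
  have hover : 16 * (F.filter fun y => ¬ cover A c i y < L).card ≤ Fintype.card S := by
    refine Nat.le_of_mul_le_mul_left ?_ h.trunc_pos
    calc L * (16 * (F.filter fun y => ¬ cover A c i y < L).card)
        = 16 * ∑ _y ∈ F.filter (fun y => ¬ cover A c i y < L), L := by
          rw [sum_const, smul_eq_mul]; ring
      _ ≤ 16 * ∑ y ∈ F.filter (fun y => ¬ cover A c i y < L), cover A c i y := by
          gcongr with y hy
          exact not_lt.mp (mem_filter.mp hy).2
      _ ≤ 16 * ∑ y, cover A c i y := by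
          gcongr
          exact subset_univ _
      _ ≤ 16 * (M * a) := by gcongr; exact h.sum_cover_le c i
      _ ≤ L * Fintype.card S := by rw [← mul_assoc]; exact h.trunc
  have hsplit : G.card + (F.filter fun y => ¬ cover A c i y < L).card = F.card :=
    card_filter_add_card_filter_not (s := F) _
  have hsum : a * G.card ≤ ∑ x ∈ F, gain A B L c i x + a * Fᶜ.card := by
    have hgain : ∀ x, gain A B L c i x = (G.filter fun y => A x y).card := fun x => by
      rw [gain, hG, filter_filter, ← hF]
      congr 1
      exact filter_congr fun y _ => and_comm
    calc a * G.card = ∑ y ∈ G, (univ.filter fun x => A x y).card := by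
          simp [h.card_in, mul_comm]
      _ = ∑ x, (G.filter fun y => A x y).card :=
          (sum_card_bipartiteAbove_eq_sum_card_bipartiteBelow (s := univ) (t := G) A).symm
      _ = ∑ x ∈ F, (G.filter fun y => A x y).card + ∑ x ∈ Fᶜ, (G.filter fun y => A x y).card :=
          (sum_add_sum_compl F _).symm
      _ ≤ ∑ x ∈ F, gain A B L c i x + ∑ _x ∈ Fᶜ, a := by
          refine add_le_add (sum_le_sum fun x _ => (hgain x).ge) (sum_le_sum fun x _ => ?_)
          rw [← h.card_out x]
          exact card_le_card (filter_subset_filter _ (subset_univ _))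
      _ = _ := by rw [sum_const, smul_eq_mul, mul_comm a]
  have hcard : F.card + 2 * Fᶜ.card ≤ 2 * G.card := by omega
  have := Nat.mul_le_mul_left a hcard
  nlinarith

lemma Regular.gain_le (h : Regular A B a M L) (c : Fin M → S) (i : ℕ) (x : S) :
    gain A B L c i x ≤ a := by
  rw [← h.card_out x]
  exact card_le_card fun y => by simp +contextual

lemma Regular.card_conflict' (h : Regular A B a M L) (y : S) :
    512 * M * (univ.filter fun x => B y x).card ≤ Fintype.card S := by
  convert h.card_conflict y using 4
  exact ⟨h.symm _ _, h.symm _ _⟩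

lemma Regular.loss_le (h : Regular A B a M L) (c : Fin M → S) (i : ℕ) (x : S) :
    512 * M * loss A B L c i x ≤ L * Fintype.card S := by
  calc 512 * M * loss A B L c i x
      ≤ 512 * M * ∑ _y ∈ univ.filter (fun y => B y x), L := by
        unfold loss
        gcongr
        refine (sum_le_sum fun y _ => min_le_right _ L).trans (sum_le_sum_of_subset ?_)
        exact filter_subset_filter _ (subset_univ _)
    _ = L * (512 * M * (univ.filter fun y => B y x).card) := by
        rw [sum_const, smul_eq_mul]; ring
    _ ≤ L * Fintype.card S := by gcongr; exact h.card_conflict x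

lemma Regular.sum_loss (h : Regular A B a M L) (c : Fin M → S) (i : ℕ) :
    256 * ∑ x ∈ feas B c i, loss A B L c i x ≤ a * (feas B c i).card := by
  have hM : 0 < M := by have := h.size; omega
  have key : 512 * M * ∑ x ∈ feas B c i, loss A B L c i x ≤ M * a * Fintype.card S := by
    calc 512 * M * ∑ x ∈ feas B c i, loss A B L c i x
        ≤ 512 * M * ∑ x, ∑ y, if B y x then cover A c i y else 0 := by
          gcongr 512 * M * ?_
          refine (sum_le_sum_of_subset (subset_univ _)).trans (sum_le_sum fun x _ => ?_)
          rw [← sum_filter]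
          refine (sum_le_sum fun y _ => min_le_left _ _).trans (sum_le_sum_of_subset ?_)
          exact filter_subset_filter _ (subset_univ _)
      _ = ∑ y, cover A c i y * (512 * M * (univ.filter fun x => B y x).card) := by
          rw [sum_comm, mul_sum]
          refine sum_congr rfl fun y _ => ?_
          rw [← sum_filter, sum_const, smul_eq_mul]
          ring
      _ ≤ ∑ y, cover A c i y * Fintype.card S := by
          gcongr with y
          exact h.card_conflict' y
      _ ≤ M * a * Fintype.card S := by
          rw [← sum_mul]
          gcongr
          exact h.sum_cover_le c i
  have key' : 512 * ∑ x ∈ feas B c i, loss A B L c i x ≤ a * Fintype.card S := by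
    refine Nat.le_of_mul_le_mul_left ?_ hM
    linarith
  have hcard : Fintype.card S ≤ 2 * (feas B c i).card := by
    have := h.card_feas c i
    omega
  have := Nat.mul_le_mul_left a hcard
  nlinarith

lemma exp_neg_le_one_sub_half {z : ℝ} (h0 : 0 ≤ z) (h1 : z ≤ 1) :
    Real.exp (-z) ≤ 1 - z / 2 := by
  have hc := convexOn_exp.2 (Set.mem_univ (0 : ℝ)) (Set.mem_univ (-1 : ℝ))
    (sub_nonneg.mpr h1) h0 (by ring)
  have he : Real.exp (-1) ≤ 1 / 2 := by
    rw [Real.exp_neg, one_div]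
    exact inv_anti₀ (by norm_num) (by linarith [Real.add_one_le_exp (1 : ℝ)])
  simp only [smul_eq_mul, mul_zero, zero_add, Real.exp_zero, mul_one, mul_neg] at hc
  nlinarith

lemma exp_le_one_add_two_mul {z : ℝ} (h0 : 0 ≤ z) (h1 : z ≤ 1) : Real.exp z ≤ 1 + 2 * z := by
  have hc := convexOn_exp.2 (Set.mem_univ (0 : ℝ)) (Set.mem_univ (1 : ℝ))
    (sub_nonneg.mpr h1) h0 (by ring)
  have he : Real.exp 1 ≤ 3 := by linarith [Real.exp_one_lt_d9]
  simp only [smul_eq_mul, mul_zero, zero_add, Real.exp_zero, mul_one] at hc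
  nlinarith

lemma Regular.mean_exp_gain (h : Regular A B a M L) (k : ℕ) (hk : k ≤ M) :
    mean B (fun c : Fin M → S => Real.exp (-∑ i ∈ univ.filter (fun i : Fin M => (i : ℕ) < k),
      (gain A B L c i (c i) : ℝ) / a)) ≤ Real.exp (-(k / 4 : ℝ)) := by
  have := h.nonempty
  have ha : (0 : ℝ) < a := by exact_mod_cast h.deg_pos
  have := mean_prod_le (B := B)
    (fun c i x => if (i : ℕ) < k then Real.exp (-((gain A B L c i x : ℝ) / a)) else 1)
    (fun i : Fin M => if (i : ℕ) < k then Real.exp (-(1 / 4 : ℝ)) else 1)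
    (fun c i x => by split_ifs <;> positivity)
    (fun c c' i x hc => by rw [gain_congr hc]) (fun c i => h.feas_nonempty c i) ?_
  · simp only [← prod_filter, ← Real.exp_sum, prod_const, ← Real.exp_nat_mul, sum_neg_distrib] at this
    refine this.trans_eq ?_
    rw [Fin.card_filter_val_lt, min_eq_right hk]
    ring_nf
  · intro c i
    split_ifs
    · have hs : (a : ℝ) * (feas B c i).card ≤ 2 * ∑ x ∈ feas B c i, (gain A B L c i x : ℝ) := by
        exact_mod_cast h.sum_gain c i
      calc ∑ x ∈ feas B c i, Real.exp (-((gain A B L c i x : ℝ) / a))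
          ≤ ∑ x ∈ feas B c i, (1 - (gain A B L c i x : ℝ) / a / 2) := by
            refine sum_le_sum fun x _ => exp_neg_le_one_sub_half (by positivity) ?_
            rw [div_le_one ha]
            exact_mod_cast h.gain_le c i x
        _ = (feas B c i).card - (∑ x ∈ feas B c i, (gain A B L c i x : ℝ)) / a / 2 := by
            rw [sum_sub_distrib, sum_div, sum_div]
            simp
        _ ≤ (1 - 1 / 4) * (feas B c i).card := by
            have : ((feas B c i).card : ℝ) / 2 ≤ (∑ x ∈ feas B c i, (gain A B L c i x : ℝ)) / a := by
              rw [le_div_iff₀ ha]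
              linarith
            linarith
        _ ≤ _ := by
            gcongr
            linarith [Real.add_one_le_exp (-(1 / 4 : ℝ))]
    · simp

lemma Regular.mean_exp_loss (h : Regular A B a M L) :
    mean B (fun c : Fin M → S => Real.exp (∑ i : Fin M,
      512 * M * (loss A B L c i (c i) : ℝ) / (L * Fintype.card S))) ≤
      Real.exp (4 * ((M : ℝ) ^ 2 * a / (L * Fintype.card S))) := by
  have := h.nonempty
  have hS : (0 : ℝ) < Fintype.card S := by exact_mod_cast h.card_pos
  have hL : (0 : ℝ) < L := by exact_mod_cast h.trunc_pos
  have := mean_prod_le (B := B)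
    (fun c i x => Real.exp (512 * M * (loss A B L c i x : ℝ) / (L * Fintype.card S)))
    (fun i : Fin M => Real.exp (4 * ((M : ℝ) * a / (L * Fintype.card S))))
    (fun c i x => by positivity)
    (fun c c' i x hc => by rw [loss_congr hc]) (fun c i => h.feas_nonempty c i) ?_
  · simp only [← Real.exp_sum] at this
    refine this.trans_eq ?_
    simp only [sum_const, card_univ, Fintype.card_fin, nsmul_eq_mul]
    ring_nf
  · intro c i
    have hs : 256 * ∑ x ∈ feas B c i, (loss A B L c i x : ℝ) ≤ a * (feas B c i).card := by
      exact_mod_cast h.sum_loss c i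
    calc ∑ x ∈ feas B c i, Real.exp (512 * M * (loss A B L c i x : ℝ) / (L * Fintype.card S))
        ≤ ∑ x ∈ feas B c i,
            (1 + 2 * (512 * M * (loss A B L c i x : ℝ) / (L * Fintype.card S))) := by
          refine sum_le_sum fun x _ => exp_le_one_add_two_mul (by positivity) ?_
          rw [div_le_one (by positivity)]
          exact_mod_cast h.loss_le c i x
      _ = (feas B c i).card + 4 * M / (L * Fintype.card S) *
            (256 * ∑ x ∈ feas B c i, (loss A B L c i x : ℝ)) := by
          rw [sum_add_distrib, mul_sum, mul_sum]
          congr 1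
          · simp
          · exact sum_congr rfl fun x _ => by ring
      _ ≤ (feas B c i).card + 4 * M / (L * Fintype.card S) * (a * (feas B c i).card) := by gcongr
      _ = (4 * ((M : ℝ) * a / (L * Fintype.card S)) + 1) * (feas B c i).card := by ring
      _ ≤ _ := by
          gcongr
          exact Real.add_one_le_exp _

lemma Regular.mean_loss (h : Regular A B a M L) :
    mean B (fun c : Fin M → S => ∑ i : Fin M, (loss A B L c i (c i) : ℝ)) ≤ M * a / 256 := by
  have := h.nonempty
  rw [mean_sum]
  calc ∑ i : Fin M, mean B (fun c : Fin M → S => (loss A B L c i (c i) : ℝ))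
      ≤ ∑ _i : Fin M, (a : ℝ) / 256 := by
        refine sum_le_sum fun i _ => mean_single_le
          (fun c x => (loss A B L c i x : ℝ)) i _ (fun c x => by positivity)
          (fun c c' x hc => by rw [loss_congr hc]) (fun c i => h.feas_nonempty c i) fun c => ?_
        have hs : 256 * ∑ x ∈ feas B c i, (loss A B L c i x : ℝ) ≤ a * (feas B c i).card := by
          exact_mod_cast h.sum_loss c i
        linarith
    _ = M * a / 256 := by simp; ring

lemma Regular.mean_exp_hit (h : Regular A B a M L) :
    mean B (fun c : Fin M → S => Real.exp (∑ i : Fin M,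
      ((potential A B L c i : ℝ) / (L * Fintype.card S) / 2 -
        (min (cover A c i (c i)) L : ℕ) / (L : ℝ)))) ≤ 1 := by
  have := h.nonempty
  have hS : (0 : ℝ) < Fintype.card S := by exact_mod_cast h.card_pos
  have hL : (0 : ℝ) < L := by exact_mod_cast h.trunc_pos
  have := mean_prod_le (B := B)
    (fun c i x => Real.exp ((potential A B L c i : ℝ) / (L * Fintype.card S) / 2 -
        (min (cover A c i x) L : ℕ) / (L : ℝ)))
    (fun i : Fin M => 1)
    (fun c i x => by positivity)
    (fun c c' i x hc => by rw [potential_congr hc, cover_congr hc])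
    (fun c i => h.feas_nonempty c i) ?_
  · simpa only [← Real.exp_sum, prod_const_one] using this
  · intro c i
    set ψ := (potential A B L c i : ℝ) / (L * Fintype.card S) / 2 with hψ
    have hF : (0 : ℝ) < (feas B c i).card := by exact_mod_cast (h.feas_nonempty c i).card_pos
    have hFS : ((feas B c i).card : ℝ) ≤ Fintype.card S := by exact_mod_cast card_le_univ _
    simp only [sub_eq_add_neg, Real.exp_add, ← mul_sum]
    rw [one_mul, ← le_div_iff₀' (Real.exp_pos _), div_eq_mul_inv, ← Real.exp_neg]
    calc ∑ x ∈ feas B c i, Real.exp (-((min (cover A c i x) L : ℕ) / (L : ℝ)))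
        ≤ ∑ x ∈ feas B c i, (1 - (min (cover A c i x) L : ℕ) / (L : ℝ) / 2) := by
          refine sum_le_sum fun x _ => exp_neg_le_one_sub_half (by positivity) ?_
          rw [div_le_one hL]
          exact_mod_cast min_le_right _ _
      _ = (feas B c i).card - (potential A B L c i : ℝ) / L / 2 := by
          rw [sum_sub_distrib, potential, Nat.cast_sum, sum_div, sum_div]
          simp
      _ ≤ (feas B c i).card * (1 - ψ) := by
          have : (feas B c i).card * ψ ≤ (potential A B L c i : ℝ) / L / 2 := by
            calc (feas B c i).card * ψ ≤ Fintype.card S * ψ := by gcongr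
              _ = _ := by rw [hψ]; field_simp
          linarith
      _ ≤ _ := by
          gcongr
          linarith [Real.add_one_le_exp (-ψ)]

/-- Either the gains of the first half are small, or the losses are large, or the accumulated
potential is large. -/
lemma Regular.gain_or_loss_or_potential (h : Regular A B a M L) (c : Fin M → S) :
    ∑ i ∈ univ.filter (fun i : Fin M => (i : ℕ) < M / 2), (gain A B L c i (c i) : ℝ) ≤
        a * (M / 2 : ℕ) / 8 ∨
      (a : ℝ) * M / 64 ≤ ∑ i : Fin M, (loss A B L c i (c i) : ℝ) ∨
      (M : ℝ) ^ 2 * a / (L * Fintype.card S) / 256 ≤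
        ∑ i : Fin M, (potential A B L c i : ℝ) / (L * Fintype.card S) / 2 := by
  have hS : (0 : ℝ) < Fintype.card S := by exact_mod_cast h.card_pos
  have hL : (0 : ℝ) < L := by exact_mod_cast h.trunc_pos
  by_contra! hcon
  obtain ⟨hg, hl, hp⟩ := hcon
  refine absurd hp (not_lt.mpr ?_)
  have hM2 := h.size
  have hhalf : (M : ℝ) ≤ 4 * (M / 2 : ℕ) := by
    have : M ≤ 4 * (M / 2) := by omega
    exact_mod_cast this
  have hpot : ∀ i ∈ univ.filter (fun i : Fin M => ¬ (i : ℕ) < M / 2),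
      (a : ℝ) * M / 64 ≤ potential A B L c i := by
    intro i hi
    have hi' : M / 2 ≤ (i : ℕ) := not_lt.mp (mem_filter.mp hi).2
    have hid : (potential A B L c i : ℝ) +
        ∑ j ∈ univ.filter (fun j : Fin M => (j : ℕ) < i), (loss A B L c j (c j) : ℝ) =
        ∑ j ∈ univ.filter (fun j : Fin M => (j : ℕ) < i), (gain A B L c j (c j) : ℝ) := by
      exact_mod_cast potential_add_sum_loss h.disj L c i.2.le
    have h1 : ∑ j ∈ univ.filter (fun j : Fin M => (j : ℕ) < M / 2), (gain A B L c j (c j) : ℝ) ≤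
        ∑ j ∈ univ.filter (fun j : Fin M => (j : ℕ) < i), (gain A B L c j (c j) : ℝ) :=
      sum_le_sum_of_subset_of_nonneg
        (monotone_filter_right _ fun j _ hj => lt_of_lt_of_le hj hi') fun _ _ _ => by positivity
    have h2 : ∑ j ∈ univ.filter (fun j : Fin M => (j : ℕ) < i), (loss A B L c j (c j) : ℝ) ≤
        ∑ j : Fin M, (loss A B L c j (c j) : ℝ) :=
      sum_le_sum_of_subset_of_nonneg (subset_univ _) fun _ _ _ => by positivity
    have h3 : (a : ℝ) * M ≤ a * (4 * (M / 2 : ℕ)) := by gcongr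
    linarith
  have hcard : (M : ℝ) ≤ 2 * (univ.filter (fun i : Fin M => ¬ (i : ℕ) < M / 2)).card := by
    have h1 := card_filter_add_card_filter_not (s := (univ : Finset (Fin M)))
      (fun i : Fin M => (i : ℕ) < M / 2)
    rw [Fin.card_filter_val_lt, card_univ, Fintype.card_fin] at h1
    have : M ≤ 2 * (univ.filter (fun i : Fin M => ¬ (i : ℕ) < M / 2)).card := by omega
    exact_mod_cast this
  calc (M : ℝ) ^ 2 * a / (L * Fintype.card S) / 256
      = M / 2 * ((a : ℝ) * M / 64 / (L * Fintype.card S) / 2) := by ring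
    _ ≤ (univ.filter (fun i : Fin M => ¬ (i : ℕ) < M / 2)).card *
          ((a : ℝ) * M / 64 / (L * Fintype.card S) / 2) := by
        gcongr
        linarith
    _ = ∑ _i ∈ univ.filter (fun i : Fin M => ¬ (i : ℕ) < M / 2),
          ((a : ℝ) * M / 64 / (L * Fintype.card S) / 2) := by simp
    _ ≤ ∑ i ∈ univ.filter (fun i : Fin M => ¬ (i : ℕ) < M / 2),
          (potential A B L c i : ℝ) / (L * Fintype.card S) / 2 := by
        gcongr with i hi
        exact hpot i hi
    _ ≤ _ := sum_le_sum_of_subset_of_nonneg (subset_univ _) fun _ _ _ => by positivity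

lemma sum_hit_le {S : Type} {M : ℕ} (A : S → S → Prop) (L : ℕ) (c : Fin M → S) :
    ∑ i : Fin M, ((min (cover A c i (c i)) L : ℕ) : ℝ) / L ≤ pairCount A c / L := by
  rw [← sum_div]
  gcongr
  exact_mod_cast sum_min_cover_le A L c

/-- Markov bound for the gains of the first half of the codewords. -/
lemma Regular.mean_exp_half_gain (h : Regular A B a M L) :
    mean B (fun c : Fin M → S => Real.exp ((M / 2 : ℕ) / 8 -
      ∑ i ∈ univ.filter (fun i : Fin M => (i : ℕ) < M / 2), (gain A B L c i (c i) : ℝ) / a)) ≤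
      Real.exp (-((M / 2 : ℕ) / 8 : ℝ)) := by
  have h1 := h.mean_exp_gain (M / 2) (Nat.div_le_self _ _)
  simp only [sub_eq_add_neg, Real.exp_add, mean_const_mul]
  calc _ ≤ Real.exp ((M / 2 : ℕ) / 8) * Real.exp (-((M / 2 : ℕ) / 4 : ℝ)) := by gcongr
    _ = _ := by rw [← Real.exp_add]; ring_nf

/-- Lower-tail bound for the pair count. -/
theorem Regular.lower_tail (h : Regular A B a M L) {θ : ℝ}
    (hθ : θ ≤ (M : ℝ) ^ 2 * a / Fintype.card S / 512) :
    mean B (fun c : Fin M → S => if (pairCount A c : ℝ) ≤ θ then 1 else 0) ≤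
      3 * Real.exp (-((M : ℝ) ^ 2 * a / (L * Fintype.card S) / 512)) := by
  have hS : (0 : ℝ) < Fintype.card S := by exact_mod_cast h.card_pos
  have hL : (0 : ℝ) < L := by exact_mod_cast h.trunc_pos
  have ha : (0 : ℝ) < a := by exact_mod_cast h.deg_pos
  set u : ℝ := (M : ℝ) ^ 2 * a / (L * Fintype.card S) with hu
  have hu0 : 0 ≤ u := by positivity
  have hpt : ∀ c : Fin M → S, (if (pairCount A c : ℝ) ≤ θ then (1 : ℝ) else 0) ≤
      Real.exp ((M / 2 : ℕ) / 8 -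
        ∑ i ∈ univ.filter (fun i : Fin M => (i : ℕ) < M / 2), (gain A B L c i (c i) : ℝ) / a) +
      (Real.exp (-(8 * u)) * Real.exp (∑ i : Fin M,
        512 * M * (loss A B L c i (c i) : ℝ) / (L * Fintype.card S)) +
      Real.exp (-(u / 512)) * Real.exp (∑ i : Fin M,
        ((potential A B L c i : ℝ) / (L * Fintype.card S) / 2 -
          (min (cover A c i (c i)) L : ℕ) / (L : ℝ)))) := by
    intro c
    simp only [← Real.exp_add]
    split_ifs with hN
    swap
    · positivity
    rcases h.gain_or_loss_or_potential c with hc | hc | hc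
    · refine le_add_of_le_of_nonneg (Real.one_le_exp ?_) (by positivity)
      rw [← sum_div, sub_nonneg, div_le_iff₀ ha]
      linarith
    · refine le_add_of_nonneg_of_le (by positivity)
        (le_add_of_le_of_nonneg (Real.one_le_exp ?_) (by positivity))
      rw [← sum_div, ← mul_sum]
      have : 8 * u ≤ 512 * M * (∑ i : Fin M, (loss A B L c i (c i) : ℝ)) /
          (L * Fintype.card S) := by
        calc 8 * u = 512 * M * ((a : ℝ) * M / 64) / (L * Fintype.card S) := by rw [hu]; ring
          _ ≤ _ := by gcongr
      linarith
    · refine le_add_of_nonneg_of_le (by positivity)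
        (le_add_of_nonneg_of_le (by positivity) (Real.one_le_exp ?_))
      rw [sum_sub_distrib]
      have h1 := sum_hit_le A L c
      have h2 : (pairCount A c : ℝ) / L ≤ u / 512 := by
        calc (pairCount A c : ℝ) / L ≤ ((M : ℝ) ^ 2 * a / Fintype.card S / 512) / L := by
              gcongr
              exact hN.trans hθ
          _ = u / 512 := by rw [hu]; field_simp
      linarith
  refine (mean_mono hpt).trans ?_
  rw [mean_add, mean_add, mean_const_mul, mean_const_mul]
  have hgain : Real.exp (-((M / 2 : ℕ) / 8 : ℝ)) ≤ Real.exp (-(u / 512)) := by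
    have hhalf : (M : ℝ) ≤ 4 * (M / 2 : ℕ) := by
      have h2 := h.size
      have : M ≤ 4 * (M / 2) := by omega
      exact_mod_cast this
    have huM : u ≤ M / 16 := by
      have ht : (16 * M * a : ℝ) ≤ L * Fintype.card S := by exact_mod_cast h.trunc
      rw [hu, div_le_iff₀ (by positivity)]
      nlinarith [(Nat.cast_nonneg M : (0 : ℝ) ≤ M)]
    refine Real.exp_le_exp.mpr ?_
    linarith
  have hloss : Real.exp (-(8 * u)) * Real.exp (4 * u) ≤ Real.exp (-(u / 512)) := by
    rw [← Real.exp_add]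
    gcongr
    linarith
  calc _ ≤ Real.exp (-(u / 512)) + (Real.exp (-(8 * u)) * Real.exp (4 * u) +
        Real.exp (-(u / 512)) * 1) := by
        gcongr
        · exact h.mean_exp_half_gain.trans hgain
        · exact h.mean_exp_loss
        · exact h.mean_exp_hit
    _ ≤ _ := by linarith

/-- Bound on the probability that no pair is `A`-related. -/
theorem Regular.mean_pairCount_eq_zero (h : Regular A B a M L) (hM : 32 ≤ M) :
    mean B (fun c : Fin M → S => if pairCount A c = 0 then 1 else 0) *
      (1 + (M : ℝ) ^ 2 * a / (L * Fintype.card S) / 256) ≤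
      1 + (M : ℝ) ^ 2 * a / (L * Fintype.card S) / 256 / 2 := by
  have hS : (0 : ℝ) < Fintype.card S := by exact_mod_cast h.card_pos
  have hL : (0 : ℝ) < L := by exact_mod_cast h.trunc_pos
  have ha : (0 : ℝ) < a := by exact_mod_cast h.deg_pos
  have hM0 : (0 : ℝ) < M := by exact_mod_cast (by omega : 0 < M)
  set v : ℝ := (M : ℝ) ^ 2 * a / (L * Fintype.card S) / 256 with hv
  have hv0 : 0 ≤ v := by positivity
  have hpt : ∀ c : Fin M → S, (1 + v) * (if pairCount A c = 0 then (1 : ℝ) else 0) ≤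
      Real.exp (∑ i : Fin M, ((potential A B L c i : ℝ) / (L * Fintype.card S) / 2 -
          (min (cover A c i (c i)) L : ℕ) / (L : ℝ))) +
      (v * Real.exp ((M / 2 : ℕ) / 8 -
        ∑ i ∈ univ.filter (fun i : Fin M => (i : ℕ) < M / 2), (gain A B L c i (c i) : ℝ) / a) +
      v * (64 / (a * M)) * ∑ i : Fin M, (loss A B L c i (c i) : ℝ)) := by
    intro c
    split_ifs with hN
    swap
    · rw [mul_zero]; positivity
    have hhit : ∑ i : Fin M, (potential A B L c i : ℝ) / (L * Fintype.card S) / 2 ≤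
        ∑ i : Fin M, ((potential A B L c i : ℝ) / (L * Fintype.card S) / 2 -
          (min (cover A c i (c i)) L : ℕ) / (L : ℝ)) := by
      have h1 := sum_hit_le A L c
      rw [hN, Nat.cast_zero, zero_div] at h1
      rw [sum_sub_distrib]
      linarith
    have hone : (1 : ℝ) ≤ Real.exp (∑ i : Fin M,
        ((potential A B L c i : ℝ) / (L * Fintype.card S) / 2 -
          (min (cover A c i (c i)) L : ℕ) / (L : ℝ))) :=
      Real.one_le_exp (le_trans (by positivity) hhit)
    rw [mul_one]
    rcases h.gain_or_loss_or_potential c with hc | hc | hc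
    · refine add_le_add hone (le_add_of_le_of_nonneg ?_ (by positivity))
      refine le_mul_of_one_le_right hv0 (Real.one_le_exp ?_)
      rw [← sum_div, sub_nonneg, div_le_iff₀ ha]
      linarith
    · refine add_le_add hone (le_add_of_nonneg_of_le (by positivity) ?_)
      rw [mul_assoc]
      refine le_mul_of_one_le_right hv0 ?_
      calc (1 : ℝ) = 64 / (a * M) * ((a : ℝ) * M / 64) := by field_simp
        _ ≤ _ := by gcongr
    · refine le_add_of_le_of_nonneg ?_ (by positivity)
      have := Real.add_one_le_exp (∑ i : Fin M,
        ((potential A B L c i : ℝ) / (L * Fintype.card S) / 2 -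
          (min (cover A c i (c i)) L : ℕ) / (L : ℝ)))
      linarith
  rw [mul_comm, ← mean_const_mul]
  refine (mean_mono hpt).trans ?_
  rw [mean_add, mean_add, mean_const_mul, mean_const_mul]
  have hgain : Real.exp (-((M / 2 : ℕ) / 8 : ℝ)) ≤ 1 / 4 := by
    have hhalf : (16 : ℝ) ≤ (M / 2 : ℕ) := by exact_mod_cast (by omega : 16 ≤ M / 2)
    calc Real.exp (-((M / 2 : ℕ) / 8 : ℝ)) ≤ Real.exp (-1 + -1) := by
          gcongr
          linarith
      _ = Real.exp (-1) * Real.exp (-1) := Real.exp_add _ _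
      _ ≤ (1 / 2) * (1 / 2) := by
          have := exp_neg_le_one_sub_half (z := 1) zero_le_one le_rfl
          gcongr <;> linarith
      _ = 1 / 4 := by norm_num
  calc _ ≤ 1 + (v * (1 / 4) + v * (64 / (a * M)) * (M * a / 256)) := by
        gcongr
        · exact h.mean_exp_hit
        · exact h.mean_exp_half_gain.trans hgain
        · exact h.mean_loss
    _ = _ := by field_simp; ring

/-- Upper bound on the expected pair count. -/
theorem Regular.mean_pairCount_le (h : Regular A B a M L) :
    mean B (fun c : Fin M → S => (pairCount A c : ℝ)) ≤ 2 * ((M : ℝ) ^ 2 * a / Fintype.card S) := by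
  have := h.nonempty
  have hS : (0 : ℝ) < Fintype.card S := by exact_mod_cast h.card_pos
  have hbound : ∀ c : Fin M → S, ∀ i : ℕ, ∀ p : S → Prop, (univ.filter p).card = a →
      ∑ x ∈ feas B c i, (if p x then (1 : ℝ) else 0) ≤
        2 * (a / Fintype.card S) * (feas B c i).card := by
    intro c i p hp
    have hcard : (Fintype.card S : ℝ) ≤ 2 * (feas B c i).card := by
      have := h.card_feas c i
      exact_mod_cast (by omega : Fintype.card S ≤ 2 * (feas B c i).card)
    calc ∑ x ∈ feas B c i, (if p x then (1 : ℝ) else 0) ≤ a := by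
          rw [← hp, sum_boole]
          exact_mod_cast card_le_card (filter_subset_filter _ (subset_univ _))
      _ = a / Fintype.card S * Fintype.card S := by field_simp
      _ ≤ a / Fintype.card S * (2 * (feas B c i).card) := by gcongr
      _ = _ := by ring
  have hpair : ∀ m ∈ (univ : Finset (Fin M × Fin M)),
      mean B (fun c : Fin M → S => if m.1 ≠ m.2 ∧ A (c m.1) (c m.2) then (1 : ℝ) else 0) ≤
        2 * (a / Fintype.card S) := by
    rintro ⟨m, m'⟩ -
    rcases lt_trichotomy m m' with hlt | rfl | hlt
    · simp only [ne_eq, hlt.ne, not_false_eq_true, true_and]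
      refine mean_single_le (fun c x => if A (c m) x then (1 : ℝ) else 0) m' _
        (fun c x => by split_ifs <;> norm_num) (fun c c' x hc => by rw [hc m hlt])
        (fun c i => h.feas_nonempty c i) fun c => hbound c m' (fun x => A (c m) x) (h.card_out _)
    · simp only [ne_eq, not_true_eq_false, false_and, if_false]
      simp only [mean, mul_zero, sum_const_zero]
      positivity
    · simp only [ne_eq, hlt.ne', not_false_eq_true, true_and]
      refine mean_single_le (fun c x => if A x (c m') then (1 : ℝ) else 0) m _
        (fun c x => by split_ifs <;> norm_num) (fun c c' x hc => by rw [hc m' hlt])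
        (fun c i => h.feas_nonempty c i) fun c => hbound c m (fun x => A x (c m')) (h.card_in _)
  simp only [pairCount, ← sum_boole]
  rw [mean_sum]
  refine (sum_le_sum hpair).trans_eq ?_
  simp only [sum_const, card_univ, Fintype.card_prod, Fintype.card_fin, nsmul_eq_mul]
  push_cast
  ring

end Concentration

section Types

variable {β : Type} {n : ℕ}

/-- The number of occurrences of `b` in the sequence `x`. -/
def cnt (x : Fin n → β) (b : β) : ℕ := (univ.filter fun i => x i = b).card

lemma exists_perm_of_cnt_eq {x y : Fin n → β} (h : cnt x = cnt y) :
    ∃ σ : Equiv.Perm (Fin n), y = x ∘ σ := by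
  have e : ∀ b, Nonempty ({i // y i = b} ≃ {i // x i = b}) := fun b => by
    rw [← Fintype.card_eq, Fintype.card_subtype, Fintype.card_subtype]
    exact (congrFun h b).symm
  let e' : ∀ b, {i // y i = b} ≃ {i // x i = b} := fun b => (e b).some
  refine ⟨(Equiv.sigmaFiberEquiv y).symm.trans
    ((Equiv.sigmaCongrRight e').trans (Equiv.sigmaFiberEquiv x)), funext fun i => ?_⟩
  exact ((e' (y i) ⟨i, rfl⟩).2).symm

lemma cnt_comp_perm (x : Fin n → β) (σ : Equiv.Perm (Fin n)) : cnt (x ∘ σ) = cnt x := by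
  funext b
  unfold cnt
  refine card_bij (fun i _ => σ i) (by simp) (fun i _ j _ h => σ.injective h) fun j hj => ?_
  exact ⟨σ.symm j, by simpa using hj, by simp⟩

/-- The symbol counts of a sequence as bounded integers. -/
def cntFin (x : Fin n → β) (b : β) : Fin (n + 1) :=
  ⟨cnt x b, Nat.lt_succ_of_le ((card_le_univ _).trans_eq (Fintype.card_fin n))⟩

lemma cntFin_eq_iff {x y : Fin n → β} : cntFin x = cntFin y ↔ cnt x = cnt y := by
  simp [funext_iff, cntFin]

variable [Fintype β]

lemma sum_cnt (x : Fin n → β) : ∑ b, cnt x b = n := by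
  have := card_eq_sum_card_fiberwise (s := (univ : Finset (Fin n))) (t := univ) (f := x) (by simp)
  simpa [cnt] using this.symm

lemma exists_cnt_eq {k : β → ℕ} (hk : ∑ b, k b = n) : ∃ x : Fin n → β, cnt x = k := by
  have e : (Σ b, Fin (k b)) ≃ Fin n := Fintype.equivFinOfCardEq (by simp [hk])
  refine ⟨fun i => (e.symm i).1, funext fun b => ?_⟩
  have : (univ.filter fun i => (e.symm i).1 = b).card =
      (univ.filter fun s : Σ b, Fin (k b) => s.1 = b).card := by
    refine card_bij (fun i _ => e.symm i) (by simp) (fun i _ j _ h => e.symm.injective h)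
      fun s hs => ⟨e s, by simpa using hs, by simp⟩
  rw [cnt, this, ← Fintype.card_subtype]
  simpa using Fintype.card_congr (Equiv.sigmaSubtype b (β := fun b => Fin (k b)))

/-- The sequences with the same symbol counts as `x` are counted by a multinomial coefficient. -/
lemma card_cnt_eq_mul (x : Fin n → β) :
    (univ.filter fun y : Fin n → β => cnt y = cnt x).card * ∏ b, (cnt x b).factorial =
      n.factorial := by
  have hstab : ∏ b, (cnt x b).factorial =
      (univ.filter fun g : Equiv.Perm (Fin n) => x ∘ g = x).card := by
    rw [← Fintype.card_subtype, DomMulAct.stabilizer_card]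
    refine prod_congr rfl fun b _ => ?_
    rw [Fintype.card_subtype]
    rfl
  have hfib : ∀ y ∈ univ.filter (fun y : Fin n → β => cnt y = cnt x),
      (univ.filter fun g : Equiv.Perm (Fin n) => x ∘ g = y).card =
        (univ.filter fun g : Equiv.Perm (Fin n) => x ∘ g = x).card := by
    intro y hy
    obtain ⟨σ, rfl⟩ := exists_perm_of_cnt_eq (mem_filter.mp hy).2.symm
    refine card_bij (fun g _ => g * σ⁻¹) (fun g hg => ?_) (by simp)
      fun g hg => ⟨g * σ, ?_, by simp⟩
    · have hg' : x ∘ g = x ∘ σ := (mem_filter.mp hg).2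
      refine mem_filter.mpr ⟨mem_univ _, funext fun i => ?_⟩
      simpa using congrFun hg' (σ⁻¹ i)
    · have hg' : x ∘ g = x := (mem_filter.mp hg).2
      refine mem_filter.mpr ⟨mem_univ _, funext fun i => ?_⟩
      simpa using congrFun hg' (σ i)
  have := card_eq_sum_card_fiberwise (s := (univ : Finset (Equiv.Perm (Fin n))))
    (t := univ.filter fun y : Fin n → β => cnt y = cnt x) (f := fun g : Equiv.Perm (Fin n) => x ∘ g)
    (fun g _ => by simp [cnt_comp_perm])
  rw [card_univ, Fintype.card_perm, Fintype.card_fin, sum_congr rfl hfib, sum_const,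
    smul_eq_mul] at this
  rw [this, hstab]

lemma factorial_mul_pow_le (k m : ℕ) : k.factorial * k ^ m ≤ m.factorial * k ^ k := by
  rcases le_total k m with h | h
  · calc k.factorial * k ^ m = k.factorial * k ^ (m - k) * k ^ k := by
          rw [mul_assoc, ← pow_add, Nat.sub_add_cancel h]
      _ ≤ _ := Nat.mul_le_mul_right _ (Nat.factorial_mul_pow_sub_le_factorial h)
  · have hk : k.factorial ≤ m.factorial * k ^ (k - m) := by
      have := Nat.factorial_mul_descFactorial (Nat.sub_le k m)
      rw [Nat.sub_sub_self h] at this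
      rw [← this]
      exact Nat.mul_le_mul_left _ (Nat.descFactorial_le_pow _ _)
    calc k.factorial * k ^ m ≤ m.factorial * k ^ (k - m) * k ^ m :=
          Nat.mul_le_mul_right _ hk
      _ = _ := by rw [mul_assoc, ← pow_add, Nat.sub_add_cancel h]

lemma prod_comp_eq_prod_pow_cnt (k : β → ℕ) (x : Fin n → β) :
    ∏ i, k (x i) = ∏ b, k b ^ cnt x b := by
  rw [← prod_fiberwise' univ x k]
  simp [cnt]

lemma card_cnt_mul_prod_le {k : β → ℕ} (hk : ∑ b, k b = n) (x : Fin n → β) :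
    (univ.filter fun y : Fin n → β => cnt y = cnt x).card * ∏ b, k b ^ cnt x b ≤
      (univ.filter fun y : Fin n → β => cnt y = k).card * ∏ b, k b ^ k b := by
  obtain ⟨z, rfl⟩ := exists_cnt_eq hk
  have hx := card_cnt_eq_mul x
  have hz := card_cnt_eq_mul z
  refine Nat.le_of_mul_le_mul_left ?_
    (prod_pos fun b (_ : b ∈ univ) => Nat.factorial_pos (cnt z b))
  have hprod : (∏ b, (cnt z b).factorial) * ∏ b, cnt z b ^ cnt x b ≤
      (∏ b, (cnt x b).factorial) * ∏ b, cnt z b ^ cnt z b := by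
    rw [← prod_mul_distrib, ← prod_mul_distrib]
    exact prod_le_prod' fun b _ => factorial_mul_pow_le _ _
  calc _ = (univ.filter fun y : Fin n → β => cnt y = cnt x).card *
        ((∏ b, (cnt z b).factorial) * ∏ b, cnt z b ^ cnt x b) := by ring
    _ ≤ (univ.filter fun y : Fin n → β => cnt y = cnt x).card *
        ((∏ b, (cnt x b).factorial) * ∏ b, cnt z b ^ cnt z b) := Nat.mul_le_mul_left _ hprod
    _ = _ := by rw [← mul_assoc, hx, ← hz]; ring

lemma card_cnt_mul_prod_le_pow {k : β → ℕ} (hk : ∑ b, k b = n) :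
    (univ.filter fun y : Fin n → β => cnt y = k).card * ∏ b, k b ^ k b ≤ n ^ n := by
  calc _ = ∑ x ∈ univ.filter (fun y : Fin n → β => cnt y = k), ∏ i, k (x i) := by
        rw [← smul_eq_mul, ← sum_const]
        refine sum_congr rfl fun x hx => ?_
        rw [prod_comp_eq_prod_pow_cnt, (mem_filter.mp hx).2]
    _ ≤ ∑ x : Fin n → β, ∏ i, k (x i) := sum_le_sum_of_subset (subset_univ _)
    _ = n ^ n := by rw [← Fintype.sum_pow, hk]

lemma pow_le_card_cnt_mul_prod {k : β → ℕ} (hk : ∑ b, k b = n) :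
    n ^ n ≤ (n + 1) ^ Fintype.card β *
      ((univ.filter fun y : Fin n → β => cnt y = k).card * ∏ b, k b ^ k b) := by
  calc n ^ n = ∑ x : Fin n → β, ∏ i, k (x i) := by rw [← Fintype.sum_pow, hk]
    _ = ∑ f : β → Fin (n + 1), ∑ x ∈ univ.filter (fun x : Fin n → β => cntFin x = f),
          ∏ i, k (x i) := (sum_fiberwise _ _ _).symm
    _ ≤ ∑ _f : β → Fin (n + 1),
          (univ.filter fun y : Fin n → β => cnt y = k).card * ∏ b, k b ^ k b := by
        refine sum_le_sum fun f _ => ?_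
        rcases (univ.filter (fun x : Fin n → β => cntFin x = f)).eq_empty_or_nonempty with h | ⟨z, hz⟩
        · rw [h, sum_empty]; exact Nat.zero_le _
        · obtain rfl := (mem_filter.mp hz).2
          refine le_trans (le_of_eq ?_) (card_cnt_mul_prod_le hk z)
          simp only [cntFin_eq_iff]
          rw [← smul_eq_mul, ← sum_const]
          refine sum_congr rfl fun x hx => ?_
          rw [prod_comp_eq_prod_pow_cnt, (mem_filter.mp hx).2]
    _ = _ := by simp

/-- Shannon entropy. -/
def ent (p : β → ℝ) : ℝ := ∑ b, Real.negMulLog (p b)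

lemma typeClass_eq_filter_cnt (hn : 0 < n) {p : β → ℝ} {k : β → ℕ} (hk : ∀ b, p b * n = k b) :
    typeClass n p = univ.filter fun y : Fin n → β => cnt y = k := by
  have hn' : (0 : ℝ) < n := by exact_mod_cast hn
  refine filter_congr fun x _ => ?_
  rw [funext_iff, funext_iff]
  refine forall_congr' fun b => ?_
  rw [← Nat.cast_inj (R := ℝ), ← hk b, ← div_eq_iff hn'.ne']
  rfl

lemma prod_pow_mul_exp_ent (hn : 0 < n) {p : β → ℝ} (hp : ∑ b, p b = 1) {k : β → ℕ}
    (hk : ∀ b, p b * n = k b) :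
    (∏ b, (k b : ℝ) ^ k b) * Real.exp (n * ent p) = (n : ℝ) ^ n := by
  have hn' : (0 : ℝ) < n := by exact_mod_cast hn
  have hsum : ∑ b, k b = n := by
    have : (∑ b, (k b : ℝ)) = n := by simp only [← hk, ← sum_mul, hp, one_mul]
    exact_mod_cast this
  rw [ent, mul_sum, Real.exp_sum, ← prod_mul_distrib]
  calc _ = ∏ b, (n : ℝ) ^ k b := by
        refine prod_congr rfl fun b _ => ?_
        rcases Nat.eq_zero_or_pos (k b) with h0 | hpos
        · have : p b = 0 := by
            have := hk b
            rw [h0, Nat.cast_zero] at this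
            exact (mul_eq_zero.mp this).resolve_right hn'.ne'
          simp [h0, this]
        · have hpos' : (0 : ℝ) < k b := by exact_mod_cast hpos
          have hpb : 0 < p b := pos_of_mul_pos_left (hk b ▸ hpos') hn'.le
          have : n * Real.negMulLog (p b) = -(k b * Real.log (p b)) := by
            rw [Real.negMulLog, ← hk b]; ring
          rw [this, Real.exp_neg, Real.exp_nat_mul, Real.exp_log hpb]
          rw [← div_eq_mul_inv, div_eq_iff (by positivity), ← mul_pow, ← hk b, mul_comm]
    _ = (n : ℝ) ^ n := by rw [prod_pow_eq_pow_sum, hsum]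

lemma exists_counts {p : β → ℝ} (hp : IsDist p) (ht : IsTypeDist n p) :
    ∃ k : β → ℕ, (∀ b, p b * n = k b) ∧ ∑ b, k b = n := by
  choose k hk using ht
  refine ⟨k, hk, ?_⟩
  have : (∑ b, (k b : ℝ)) = n := by simp only [← hk, ← sum_mul, hp.2, one_mul]
  exact_mod_cast this

lemma prod_self_pow_pos (k : β → ℕ) : (0 : ℝ) < ∏ b, (k b : ℝ) ^ k b := by
  refine prod_pos fun b _ => ?_
  rcases Nat.eq_zero_or_pos (k b) with h0 | hpos
  · simp [h0]
  · positivity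

lemma card_typeClass_le (hn : 0 < n) {p : β → ℝ} (hp : IsDist p) (ht : IsTypeDist n p) :
    ((typeClass n p).card : ℝ) ≤ Real.exp (n * ent p) := by
  obtain ⟨k, hk, hsum⟩ := exists_counts hp ht
  have h1 : ((typeClass n p).card : ℝ) * ∏ b, (k b : ℝ) ^ k b ≤ (n : ℝ) ^ n := by
    rw [typeClass_eq_filter_cnt hn hk]
    exact_mod_cast card_cnt_mul_prod_le_pow hsum
  rw [← prod_pow_mul_exp_ent hn hp.2 hk, mul_comm] at h1
  exact le_of_mul_le_mul_left h1 (prod_self_pow_pos k)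

lemma exp_ent_le_card_typeClass (hn : 0 < n) {p : β → ℝ} (hp : IsDist p) (ht : IsTypeDist n p) :
    Real.exp (n * ent p) ≤ ((n : ℝ) + 1) ^ Fintype.card β * (typeClass n p).card := by
  obtain ⟨k, hk, hsum⟩ := exists_counts hp ht
  have h1 : (n : ℝ) ^ n ≤ ((n : ℝ) + 1) ^ Fintype.card β *
      ((typeClass n p).card * ∏ b, (k b : ℝ) ^ k b) := by
    rw [typeClass_eq_filter_cnt hn hk]
    exact_mod_cast pow_le_card_cnt_mul_prod hsum
  rw [← prod_pow_mul_exp_ent hn hp.2 hk, ← mul_assoc, mul_comm] at h1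
  exact le_of_mul_le_mul_right h1 (prod_self_pow_pos k)

end Types

section Pairs

variable {α : Type} [Fintype α] {n : ℕ}

lemma emp_eq_cnt (x : Fin n → α) (a : α) : emp n x a = cnt x a / n := rfl

lemma emp2_eq_emp {α β : Type} [Fintype α] [Fintype β] (x : Fin n → α) (y : Fin n → β) :
    emp2 n x y = emp n fun i => (x i, y i) := by
  funext p
  simp [emp2, emp, Prod.ext_iff]

lemma cnt_eq_of_emp_eq (hn : 0 < n) {x y : Fin n → α} (h : emp n x = emp n y) :
    cnt x = cnt y := by
  have hn' : (n : ℝ) ≠ 0 := by exact_mod_cast hn.ne'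
  funext a
  have := congrFun h a
  rw [emp_eq_cnt, emp_eq_cnt, div_left_inj' hn'] at this
  exact_mod_cast this

lemma emp_comp_perm (x : Fin n → α) (σ : Equiv.Perm (Fin n)) : emp n (x ∘ σ) = emp n x := by
  funext a
  rw [emp_eq_cnt, emp_eq_cnt, cnt_comp_perm]

lemma emp2_comp_perm (x y : Fin n → α) (σ : Equiv.Perm (Fin n)) :
    emp2 n (x ∘ σ) (y ∘ σ) = emp2 n x y := by
  rw [emp2_eq_emp, emp2_eq_emp]
  exact emp_comp_perm (fun i => (x i, y i)) σ

lemma emp2_swap (x y : Fin n → α) : emp2 n y x = fun p => emp2 n x y (p.2, p.1) := by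
  funext p
  simp [emp2, and_comm]

lemma isDist_emp (hn : 0 < n) (x : Fin n → α) : IsDist (emp n x) := by
  have hn' : (n : ℝ) ≠ 0 := by exact_mod_cast hn.ne'
  refine ⟨fun a => by rw [emp_eq_cnt]; positivity, ?_⟩
  simp only [emp_eq_cnt, ← sum_div, ← Nat.cast_sum, sum_cnt]
  exact div_self hn'

lemma isTypeDist_emp (hn : 0 < n) (x : Fin n → α) : IsTypeDist n (emp n x) := by
  have hn' : (n : ℝ) ≠ 0 := by exact_mod_cast hn.ne'
  exact fun a => ⟨cnt x a, by rw [emp_eq_cnt, div_mul_cancel₀ _ hn']⟩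

lemma sum_cnt_pair_left (w : Fin n → α × α) (a : α) :
    ∑ b, cnt w (a, b) = cnt (fun i => (w i).1) a := by
  unfold cnt
  rw [card_eq_sum_card_fiberwise (s := univ.filter fun i => (w i).1 = a) (t := univ)
    (f := fun i => (w i).2) (by simp)]
  refine sum_congr rfl fun b _ => ?_
  rw [filter_filter]
  simp only [Prod.ext_iff]

lemma sum_cnt_pair_right (w : Fin n → α × α) (b : α) :
    ∑ a, cnt w (a, b) = cnt (fun i => (w i).2) b := by
  unfold cnt
  rw [card_eq_sum_card_fiberwise (s := univ.filter fun i => (w i).2 = b) (t := univ)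
    (f := fun i => (w i).1) (by simp)]
  refine sum_congr rfl fun a _ => ?_
  rw [filter_filter]
  simp only [Prod.ext_iff, and_comm]

lemma sum_emp_left (w : Fin n → α × α) (a : α) :
    ∑ b, emp n w (a, b) = emp n (fun i => (w i).1) a := by
  simp only [emp_eq_cnt, ← sum_div, ← Nat.cast_sum, sum_cnt_pair_left]

lemma sum_emp_right (w : Fin n → α × α) (b : α) :
    ∑ a, emp n w (a, b) = emp n (fun i => (w i).2) b := by
  simp only [emp_eq_cnt, ← sum_div, ← Nat.cast_sum, sum_cnt_pair_right]

variable {Q : α → ℝ} {P : α × α → ℝ}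

lemma mem_typeClass {x : Fin n → α} : x ∈ typeClass n Q ↔ emp n x = Q := by
  simp [typeClass]

lemma joint_emp2 (hn : 0 < n) {x y : Fin n → α} (hx : x ∈ typeClass n Q)
    (hy : y ∈ typeClass n Q) : Joint Q (emp2 n x y) := by
  rw [emp2_eq_emp]
  refine ⟨isDist_emp hn _, fun a => ?_, fun b => ?_⟩
  · rw [sum_emp_left, mem_typeClass.mp hx]
  · rw [sum_emp_right, mem_typeClass.mp hy]

lemma Joint.fst_mem (hP : Joint Q P) {w : Fin n → α × α} (hw : w ∈ typeClass n P) :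
    (fun i => (w i).1) ∈ typeClass n Q := by
  rw [mem_typeClass] at *
  funext a
  rw [← sum_emp_left, hw, hP.2.1]

lemma Joint.snd_mem (hP : Joint Q P) {w : Fin n → α × α} (hw : w ∈ typeClass n P) :
    (fun i => (w i).2) ∈ typeClass n Q := by
  rw [mem_typeClass] at *
  funext a
  rw [← sum_emp_right, hw, hP.2.2]

lemma card_emp2_eq_left (hn : 0 < n) {x x' : Fin n → α} (hx : x ∈ typeClass n Q)
    (hx' : x' ∈ typeClass n Q) :
    ((typeClass n Q).filter fun y => emp2 n x y = P).card =
      ((typeClass n Q).filter fun y => emp2 n x' y = P).card := by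
  obtain ⟨σ, rfl⟩ := exists_perm_of_cnt_eq (cnt_eq_of_emp_eq hn
    ((mem_typeClass.mp hx).trans (mem_typeClass.mp hx').symm))
  refine card_bij (fun y _ => y ∘ σ) (fun y hy => ?_)
    (fun y _ y' _ h => σ.surjective.injective_comp_right h)
    fun y hy => ⟨y ∘ σ.symm, ?_, by rw [Function.comp_assoc]; simp⟩
  · rw [mem_filter, mem_typeClass] at *
    rwa [emp_comp_perm, emp2_comp_perm]
  · rw [mem_filter, mem_typeClass] at *
    rw [emp_comp_perm, ← emp2_comp_perm _ _ σ, Function.comp_assoc]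
    simpa using hy

lemma card_emp2_eq_right (hn : 0 < n) {y y' : Fin n → α} (hy : y ∈ typeClass n Q)
    (hy' : y' ∈ typeClass n Q) :
    ((typeClass n Q).filter fun x => emp2 n x y = P).card =
      ((typeClass n Q).filter fun x => emp2 n x y' = P).card := by
  have key : ∀ z : Fin n → α, ((typeClass n Q).filter fun x => emp2 n x z = P) =
      (typeClass n Q).filter fun x => emp2 n z x = fun p => P (p.2, p.1) := fun z => by
    refine filter_congr fun x _ => ?_
    rw [emp2_swap x z, funext_iff, funext_iff]
    exact ⟨fun h p => h (p.2, p.1), fun h p => h (p.2, p.1)⟩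
  rw [key, key]
  exact card_emp2_eq_left hn hy hy'

lemma sum_card_emp2_left (hP : Joint Q P) :
    ∑ x ∈ typeClass n Q, ((typeClass n Q).filter fun y => emp2 n x y = P).card =
      (typeClass n P).card := by
  rw [card_eq_sum_card_fiberwise (s := typeClass n P) (t := typeClass n Q)
    (f := fun w i => (w i).1) fun w hw => hP.fst_mem hw]
  refine sum_congr rfl fun x _ => ?_
  refine card_bij (fun y _ i => (x i, y i)) (fun y hy => ?_) (fun y _ y' _ h => ?_)
    fun w hw => ⟨fun i => (w i).2, ?_, ?_⟩
  · rw [mem_filter, mem_typeClass, ← emp2_eq_emp]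
    exact ⟨(mem_filter.mp hy).2, rfl⟩
  · exact funext fun i => (Prod.ext_iff.mp (congrFun h i)).2
  · obtain ⟨hwP, rfl⟩ := mem_filter.mp hw
    exact mem_filter.mpr ⟨hP.snd_mem hwP, by rw [emp2_eq_emp]; exact mem_typeClass.mp hwP⟩
  · obtain ⟨-, rfl⟩ := mem_filter.mp hw
    rfl

lemma sum_card_emp2_right (hP : Joint Q P) :
    ∑ y ∈ typeClass n Q, ((typeClass n Q).filter fun x => emp2 n x y = P).card =
      (typeClass n P).card := by
  rw [← sum_card_emp2_left hP]
  simp only [card_filter]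
  exact sum_comm

/-- The bipartite graph of pairs with joint empirical distribution `P` on a type class is
regular. -/
lemma exists_degree (hn : 0 < n) (hP : Joint Q P) (hT : (typeClass n Q).Nonempty) :
    ∃ a : ℕ, (∀ x ∈ typeClass n Q, ((typeClass n Q).filter fun y => emp2 n x y = P).card = a) ∧
      (∀ y ∈ typeClass n Q, ((typeClass n Q).filter fun x => emp2 n x y = P).card = a) ∧
      (typeClass n Q).card * a = (typeClass n P).card := by
  obtain ⟨z, hz⟩ := hT
  have hl := sum_card_emp2_left (n := n) hP
  have hr := sum_card_emp2_right (n := n) hP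
  rw [sum_congr rfl fun x hx => card_emp2_eq_left hn hx hz, sum_const, smul_eq_mul] at hl
  rw [sum_congr rfl fun x hx => card_emp2_eq_right hn hx hz, sum_const, smul_eq_mul] at hr
  have hlr := Nat.eq_of_mul_eq_mul_left (card_pos.mpr ⟨z, hz⟩) (hl.trans hr.symm)
  exact ⟨_, fun x hx => card_emp2_eq_left hn hx hz,
    fun y hy => (card_emp2_eq_right hn hy hz).trans hlr.symm, hl⟩

lemma Joint.mutInf_eq (hP : Joint Q P) : mutInf P = 2 * ent Q - ent P := by
  have h0 : ∀ a b, P (a, b) ≤ Q a := fun a b => by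
    rw [← hP.2.1 a]
    exact single_le_sum (f := fun b => P (a, b)) (fun b _ => hP.1.1 (a, b)) (mem_univ b)
  have h1 : ∀ a b, P (a, b) ≤ Q b := fun a b => by
    rw [← hP.2.2 b]
    exact single_le_sum (f := fun a => P (a, b)) (fun a _ => hP.1.1 (a, b)) (mem_univ a)
  have hterm : ∀ p : α × α, P p * Real.log (P p / ((∑ b, P (p.1, b)) * (∑ a, P (a, p.2)))) =
      -Real.negMulLog (P p) - P p * Real.log (Q p.1) - P p * Real.log (Q p.2) := by
    rintro ⟨a, b⟩
    rw [hP.2.1, hP.2.2]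
    rcases (hP.1.1 (a, b)).eq_or_lt with h | h
    · simp [← h]
    · have ha : 0 < Q a := h.trans_le (h0 a b)
      have hb : 0 < Q b := h.trans_le (h1 a b)
      rw [Real.log_div h.ne' (mul_pos ha hb).ne', Real.log_mul ha.ne' hb.ne', Real.negMulLog]
      ring
  unfold mutInf
  rw [sum_congr rfl fun p _ => hterm p, sum_sub_distrib, sum_sub_distrib, sum_neg_distrib]
  have hl : ∑ p : α × α, P p * Real.log (Q p.1) = -ent Q := by
    rw [Fintype.sum_prod_type, ent, ← sum_neg_distrib]
    refine sum_congr rfl fun a _ => ?_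
    simp only
    rw [← sum_mul, hP.2.1, Real.negMulLog]
    ring
  have hr : ∑ p : α × α, P p * Real.log (Q p.2) = -ent Q := by
    rw [Fintype.sum_prod_type_right, ent, ← sum_neg_distrib]
    refine sum_congr rfl fun b _ => ?_
    simp only
    rw [← sum_mul, hP.2.2, Real.negMulLog]
    ring
  rw [hl, hr, ent, ent]
  ring

lemma Joint.isDist_marginal (hP : Joint Q P) : IsDist Q := by
  refine ⟨fun a => ?_, ?_⟩
  · rw [← hP.2.1 a]
    exact sum_nonneg fun b _ => hP.1.1 _
  · rw [← hP.1.2, Fintype.sum_prod_type]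
    exact sum_congr rfl fun a _ => (hP.2.1 a).symm

lemma Joint.isTypeDist_marginal (hP : Joint Q P) (ht : IsTypeDist n P) : IsTypeDist n Q := by
  intro a
  choose k hk using ht
  refine ⟨∑ b, k (a, b), ?_⟩
  rw [← hP.2.1 a, sum_mul]
  push_cast
  exact sum_congr rfl fun b _ => hk _

lemma typeClass_nonempty (hn : 0 < n) {p : α → ℝ} (hp : IsDist p) (ht : IsTypeDist n p) :
    (typeClass n p).Nonempty := by
  have := exp_ent_le_card_typeClass hn hp ht
  rw [← card_pos]
  by_contra! h
  rw [Nat.le_zero.mp h] at this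
  simp only [Nat.cast_zero, mul_zero] at this
  exact (Real.exp_pos _).not_ge this

/-- Upper bound on the density of a conditional type class. -/
lemma Joint.degree_le (hn : 0 < n) (hP : Joint Q P) (ht : IsTypeDist n P) {a : ℕ}
    (ha : (typeClass n Q).card * a = (typeClass n P).card) :
    (a : ℝ) ≤ ((n : ℝ) + 1) ^ (2 * Fintype.card α) * Real.exp (-(n * mutInf P)) *
      (typeClass n Q).card := by
  have hQ := hP.isDist_marginal
  have htQ := hP.isTypeDist_marginal ht
  have hτ : (0 : ℝ) < (typeClass n Q).card := by
    exact_mod_cast card_pos.mpr (typeClass_nonempty hn hQ htQ)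
  have h1 := card_typeClass_le hn hP.1 ht
  have h2 := exp_ent_le_card_typeClass hn hQ htQ
  have ha' : ((typeClass n Q).card : ℝ) * a = (typeClass n P).card := by exact_mod_cast ha
  rw [← ha'] at h1
  refine le_of_mul_le_mul_left (h1.trans ?_) hτ
  have h3 := pow_le_pow_left₀ (Real.exp_pos _).le h2 2
  have h4 : Real.exp (n * ent P) = Real.exp (-(n * mutInf P)) * Real.exp (n * ent Q) ^ 2 := by
    rw [← Real.exp_nat_mul, ← Real.exp_add, hP.mutInf_eq]
    congr 1
    push_cast
    ring
  rw [h4]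
  refine (mul_le_mul_of_nonneg_left h3 (Real.exp_pos _).le).trans_eq ?_
  ring

/-- Lower bound on the density of a conditional type class. -/
lemma Joint.le_degree (hn : 0 < n) (hP : Joint Q P) (ht : IsTypeDist n P) {a : ℕ}
    (ha : (typeClass n Q).card * a = (typeClass n P).card) :
    Real.exp (-(n * mutInf P)) * (typeClass n Q).card ≤
      ((n : ℝ) + 1) ^ Fintype.card (α × α) * a := by
  have hQ := hP.isDist_marginal
  have htQ := hP.isTypeDist_marginal ht
  have hτ : (0 : ℝ) < (typeClass n Q).card := by
    exact_mod_cast card_pos.mpr (typeClass_nonempty hn hQ htQ)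
  have h1 := exp_ent_le_card_typeClass hn hP.1 ht
  have h2 := card_typeClass_le hn hQ htQ
  have ha' : ((typeClass n Q).card : ℝ) * a = (typeClass n P).card := by exact_mod_cast ha
  rw [← ha'] at h1
  refine le_of_mul_le_mul_left ?_ hτ
  have h3 := pow_le_pow_left₀ hτ.le h2 2
  have h4 : Real.exp (n * ent P) = Real.exp (-(n * mutInf P)) * Real.exp (n * ent Q) ^ 2 := by
    rw [← Real.exp_nat_mul, ← Real.exp_add, hP.mutInf_eq]
    congr 1
    push_cast
    ring
  rw [h4] at h1
  have h5 := (mul_le_mul_of_nonneg_left h3 (Real.exp_pos (-(n * mutInf P))).le).trans h1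
  linarith

/-- Bound on the number of sequences of a type class in conflict with a given one, when every
conflicting joint distribution has mutual information at least `I`. -/
lemma card_conflict_le (hn : 0 < n) {d : (α × α → ℝ) → ℝ} {Δ I : ℝ}
    (hI : ∀ P, Joint Q P → d P ≤ Δ → I ≤ mutInf P) {x : Fin n → α} (hx : x ∈ typeClass n Q) :
    (((typeClass n Q).filter fun z => d (emp2 n z x) ≤ Δ).card : ℝ) ≤
      ((n : ℝ) + 1) ^ (2 * Fintype.card α + Fintype.card (α × α)) * Real.exp (-(n * I)) *
        (typeClass n Q).card := by
  set s := (typeClass n Q).filter fun z => d (emp2 n z x) ≤ Δ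
  let f : (Fin n → α) → (α × α → Fin (n + 1)) := fun z => cntFin fun i => (z i, x i)
  have hfib : ∀ z ∈ s, ((s.filter fun y => f y = f z).card : ℝ) ≤
      ((n : ℝ) + 1) ^ (2 * Fintype.card α) * Real.exp (-(n * I)) * (typeClass n Q).card := by
    intro z hz
    obtain ⟨hzT, hzd⟩ := mem_filter.mp hz
    have hJ := joint_emp2 hn hzT hx
    have ht : IsTypeDist n (emp2 n z x) := by rw [emp2_eq_emp]; exact isTypeDist_emp hn _
    obtain ⟨a, -, har, ha⟩ := exists_degree hn hJ ⟨x, hx⟩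
    have hsub : (s.filter fun y => f y = f z) ⊆
        (typeClass n Q).filter fun y => emp2 n y x = emp2 n z x := by
      intro y hy
      obtain ⟨hy, hfy⟩ := mem_filter.mp hy
      refine mem_filter.mpr ⟨(mem_filter.mp hy).1, ?_⟩
      rw [emp2_eq_emp, emp2_eq_emp]
      funext p
      rw [emp_eq_cnt, emp_eq_cnt, cntFin_eq_iff.mp hfy]
    have h1 : ((s.filter fun y => f y = f z).card : ℝ) ≤ a := by
      exact_mod_cast (card_le_card hsub).trans_eq (har x hx)
    refine h1.trans ((hJ.degree_le hn ht ha).trans ?_)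
    gcongr
    exact hI _ hJ hzd
  set K := ((n : ℝ) + 1) ^ (2 * Fintype.card α) * Real.exp (-(n * I)) * (typeClass n Q).card
  have hK : 0 ≤ K := by positivity
  have hs : (s.card : ℝ) = ∑ g : α × α → Fin (n + 1), ((s.filter fun y => f y = g).card : ℝ) := by
    exact_mod_cast card_eq_sum_card_fiberwise (s := s) (t := univ) (f := f) (by simp)
  have hg : ∀ g : α × α → Fin (n + 1), ((s.filter fun y => f y = g).card : ℝ) ≤ K := by
    intro g
    rcases (s.filter fun y => f y = g).eq_empty_or_nonempty with h | ⟨z, hz⟩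
    · rw [h]; simpa using hK
    · obtain ⟨hzs, rfl⟩ := mem_filter.mp hz
      exact hfib z hzs
  calc (s.card : ℝ) ≤ ∑ _g : α × α → Fin (n + 1), K := hs ▸ sum_le_sum fun g _ => hg g
    _ = ((n : ℝ) + 1) ^ Fintype.card (α × α) * K := by
      simp [sum_const, nsmul_eq_mul]
    _ = _ := by rw [pow_add]; ring

end Pairs

section Ensemble

variable {α : Type} [Fintype α] {n : ℕ} {Q : α → ℝ} {P : α × α → ℝ}
  {d : (α × α → ℝ) → ℝ} {Δ : ℝ} {M : ℕ}

lemma card_filter_coe {γ : Type} (T : Finset γ) (p : γ → Prop) [DecidablePred p]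
    [DecidablePred fun y : {x // x ∈ T} => p y] :
    (univ.filter fun y : {x // x ∈ T} => p y).card = (T.filter p).card :=
  card_bij (fun y _ => y.1) (fun y hy => mem_filter.mpr ⟨y.2, (mem_filter.mp hy).2⟩)
    (fun _ _ _ _ h => Subtype.ext h)
    fun y hy => ⟨⟨y, (mem_filter.mp hy).1⟩,
      mem_filter.mpr ⟨mem_univ _, (mem_filter.mp hy).2⟩, rfl⟩

/-- Two codewords of a type class are in conflict if their distance is at most `Δ`. -/
def conflict (n : ℕ) (Q : α → ℝ) (d : (α × α → ℝ) → ℝ) (Δ : ℝ)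
    (z y : {x : Fin n → α // x ∈ typeClass n Q}) : Prop :=
  d (emp2 n z.1 y.1) ≤ Δ

/-- Two codewords of a type class are linked if they have joint empirical distribution `P`. -/
def linked (n : ℕ) (Q : α → ℝ) (P : α × α → ℝ)
    (z y : {x : Fin n → α // x ∈ typeClass n Q}) : Prop :=
  emp2 n z.1 y.1 = P

lemma rgvProb_coe (c : Fin M → {x : Fin n → α // x ∈ typeClass n Q}) :
    rgvProb n Q d Δ (fun i => (c i).1) = weight (conflict n Q d Δ) c := by
  unfold rgvProb weight
  refine prod_congr rfl fun i _ => ?_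
  have hmem : ((c i).1 ∈ feasible n Q d Δ (fun i => (c i).1) i) ↔
      c i ∈ feas (conflict n Q d Δ) c i := by
    simp [feasible, feas, conflict, (c i).2]
  have hcard : (feasible n Q d Δ (fun i => (c i).1) i).card =
      (feas (conflict n Q d Δ) c i).card := by
    unfold feasible feas
    refine (Eq.trans ?_ (card_filter_coe (typeClass n Q) fun z =>
      ∀ j, j < i → Δ < d (emp2 n z (c j).1))).symm
    simp [conflict]
  by_cases h : c i ∈ feas (conflict n Q d Δ) c i
  · rw [if_pos h, if_pos (hmem.mpr h), hcard]
  · rw [if_neg h, if_neg fun h' => h (hmem.mp h')]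

lemma expect_eq_mean (F : (Fin M → Fin n → α) → ℝ) :
    expect n Q d Δ M F = mean (conflict n Q d Δ) fun c => F fun i => (c i).1 := by
  symm
  refine Fintype.sum_of_injective
    (fun (c : Fin M → {x : Fin n → α // x ∈ typeClass n Q}) i => (c i).1)
    (fun c c' h => funext fun i => Subtype.ext (congrFun h i)) _ _ (fun c hc => ?_)
    fun c => by rw [rgvProb_coe]
  have : ∃ i, c i ∉ typeClass n Q := by
    by_contra! h
    exact hc ⟨fun i => ⟨c i, h i⟩, rfl⟩
  obtain ⟨i, hi⟩ := this
  rw [rgvProb, prod_eq_zero (mem_univ i), zero_mul]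
  exact if_neg fun h => hi (mem_filter.mp h).1

lemma prob_eq_mean (E : (Fin M → Fin n → α) → Prop) :
    prob n Q d Δ M E =
      mean (conflict n Q d Δ) fun c => if E fun i => (c i).1 then (1 : ℝ) else 0 := by
  rw [← expect_eq_mean fun c => if E c then (1 : ℝ) else 0]
  simp [prob, expect]

lemma Nenum_coe (c : Fin M → {x : Fin n → α // x ∈ typeClass n Q}) :
    Nenum n P (fun i => (c i).1) = pairCount (linked n Q P) c := by
  unfold Nenum pairCount linked
  congr

lemma prob_nonneg (E : (Fin M → Fin n → α) → Prop) : 0 ≤ prob n Q d Δ M E := by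
  rw [prob_eq_mean]
  exact sum_nonneg fun c _ => mul_nonneg (weight_nonneg _ c) (by
    dsimp only
    split_ifs <;> norm_num)

lemma exists_regular (hn : 0 < n) (hd : IsDistance d) (hP : Joint Q P) (ht : IsTypeDist n P)
    (hΔ : Δ < d P) (hM : 2 ≤ M)
    (hconf : ∀ x ∈ typeClass n Q,
      512 * M * ((typeClass n Q).filter fun z => d (emp2 n z x) ≤ Δ).card ≤
        (typeClass n Q).card) :
    ∃ a L : ℕ, Regular (linked n Q P) (conflict n Q d Δ) a M L ∧
      (typeClass n Q).card * a = (typeClass n P).card ∧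
      (L : ℝ) ≤ 16 * M * (a / (typeClass n Q).card) + 1 := by
  have hT := typeClass_nonempty hn hP.isDist_marginal (hP.isTypeDist_marginal ht)
  obtain ⟨a, hal, har, ha⟩ := exists_degree hn hP hT
  have hτ : (0 : ℝ) < (typeClass n Q).card := by exact_mod_cast card_pos.mpr hT
  have ha0 : 0 < a := by
    have := card_pos.mpr (typeClass_nonempty hn hP.1 ht)
    rw [← ha] at this
    exact Nat.pos_of_mul_pos_left this
  have hr : (0 : ℝ) < 16 * M * (a / (typeClass n Q).card) := by
    have : (0 : ℝ) < M := by exact_mod_cast (by omega : 0 < M)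
    have : (0 : ℝ) < a := by exact_mod_cast ha0
    positivity
  have hsymm : ∀ x y : Fin n → α, d (emp2 n x y) = d (emp2 n y x) := fun x y => by
    rw [emp2_swap y x]; exact hd.2 _
  have hS : Fintype.card {x : Fin n → α // x ∈ typeClass n Q} = (typeClass n Q).card :=
    Fintype.card_coe _
  refine ⟨a, ⌈16 * M * ((a : ℝ) / (typeClass n Q).card)⌉₊, ?_, ha, (Nat.ceil_lt_add_one hr.le).le⟩
  refine ⟨fun x => ?_, fun y => ?_, fun x y hxy => ?_, fun x y h => ?_, fun x => ?_, ?_,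
    Nat.ceil_pos.mpr hr, ha0, hM, ?_⟩
  · convert (card_filter_coe _ fun y => emp2 n x.1 y = P).trans (hal x.1 x.2)
    exact Iff.rfl
  · convert (card_filter_coe _ fun x => emp2 n x y.1 = P).trans (har y.1 y.2)
    exact Iff.rfl
  · rw [conflict, hsymm, not_le]
    exact hΔ.trans_eq (congrArg d hxy).symm
  · rw [conflict, hsymm]; exact h
  · rw [hS]
    refine le_trans (le_of_eq (congrArg _ ?_)) (hconf x.1 x.2)
    exact card_filter_coe _ fun z => d (emp2 n z x.1) ≤ Δ
  · rw [hS]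
    have := Nat.le_ceil (16 * M * ((a : ℝ) / (typeClass n Q).card))
    rw [← mul_div_assoc, div_le_iff₀ hτ] at this
    rw [← mul_div_assoc]
    exact_mod_cast this
  · rw [hS]; exact card_pos.mpr hT

lemma eventually_poly_mul_exp_le_one (K : ℝ) (k : ℕ) {c : ℝ} (hc : 0 < c) :
    ∀ᶠ n : ℕ in atTop, K * ((n : ℝ) + 1) ^ k * Real.exp (-(n * c)) ≤ 1 := by
  have h1 : Tendsto (fun x : ℝ => x ^ k * Real.exp (-c * x)) atTop (nhds 0) := by
    simpa using tendsto_rpow_mul_exp_neg_mul_atTop_nhds_zero k c hc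
  have h2 : Tendsto (fun n : ℕ => (n : ℝ) + 1) atTop atTop :=
    tendsto_atTop_add_const_right _ _ tendsto_natCast_atTop_atTop
  have h3 := (h1.comp h2).const_mul (K * Real.exp c)
  rw [mul_zero] at h3
  filter_upwards [h3.eventually_le_const one_pos] with n hn
  refine le_trans (le_of_eq ?_) hn
  have : Real.exp (-(n * c)) = Real.exp c * Real.exp (-c * (n + 1)) := by
    rw [← Real.exp_add]
    congr 1
    ring
  simp only [Function.comp]
  rw [this]
  ring

/-- The lower tail of the type enumerator of a joint type at a given blocklength, in terms of the
density of the conditional type class. -/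
lemma prob_Nenum_le {a L : ℕ} (h : Regular (linked n Q P) (conflict n Q d Δ) a M L) (hM : 32 ≤ M)
    (hL : (L : ℝ) ≤ 16 * M * (a / (typeClass n Q).card) + 1) {s g : ℝ} (hs : 0 ≤ s)
    (hg0 : 0 ≤ g) (hgM : 17 * g ≤ M) (hgq : 17 * g ≤ (M : ℝ) ^ 2 * (a / (typeClass n Q).card))
    (hcase : (1024 * s ≤ 1 ∧ 2048 ≤ g) ∨
      (2 * s * ((M : ℝ) ^ 2 * (a / (typeClass n Q).card)) < 1 ∧ g ≤ 1)) :
    prob n Q d Δ M (fun c => (Nenum n P c : ℝ) ≤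
      s * expect n Q d Δ M fun c' => (Nenum n P c' : ℝ)) ≤ Real.exp (-(g / 1024)) := by
  have hS : Fintype.card {x : Fin n → α // x ∈ typeClass n Q} = (typeClass n Q).card :=
    Fintype.card_coe _
  have hmean := h.mean_pairCount_le
  have htail := fun θ hθ => h.lower_tail (θ := θ) hθ
  have hzero := h.mean_pairCount_eq_zero hM
  have hτ : (0 : ℝ) < (typeClass n Q).card := by rw [← hS]; exact_mod_cast h.card_pos
  have hM0 : (0 : ℝ) < M := by exact_mod_cast (by omega : 0 < M)
  have ha : (0 : ℝ) < a := by exact_mod_cast h.deg_pos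
  have hL0 : (0 : ℝ) < L := by exact_mod_cast h.trunc_pos
  rw [hS] at hmean hzero htail
  have hE : (expect n Q d Δ M fun c' => (Nenum n P c' : ℝ)) =
      mean (conflict n Q d Δ) fun c : Fin M → _ => (pairCount (linked n Q P) c : ℝ) :=
    by simp only [expect_eq_mean, Nenum_coe]
  set q : ℝ := (a : ℝ) / (typeClass n Q).card with hq
  have hq0 : 0 < q := by positivity
  have hMq : (M : ℝ) ^ 2 * a / (typeClass n Q).card = (M : ℝ) ^ 2 * q := mul_div_assoc _ _ _
  have hMqL : (M : ℝ) ^ 2 * a / (L * (typeClass n Q).card) = (M : ℝ) ^ 2 * q / L := by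
    rw [hq]; field_simp
  rw [hMq] at hmean htail
  rw [hMqL] at hzero htail
  set u : ℝ := (M : ℝ) ^ 2 * q / L with hu
  have hgu : g ≤ u := by
    rw [hu, le_div_iff₀ hL0]
    refine (mul_le_mul_of_nonneg_left hL hg0).trans ?_
    nlinarith [mul_le_mul_of_nonneg_right hgM (mul_pos hM0 hq0).le]
  set θ := s * expect n Q d Δ M fun c' => (Nenum n P c' : ℝ) with hθ
  have hθle : θ ≤ 2 * s * ((M : ℝ) ^ 2 * q) := by
    rw [hθ, hE]
    refine (mul_le_mul_of_nonneg_left hmean hs).trans_eq ?_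
    ring
  have hMq0 : 0 < (M : ℝ) ^ 2 * q := by positivity
  rw [prob_eq_mean]
  rcases hcase with ⟨hs', hg'⟩ | ⟨hs', hg'⟩
  · have := htail θ (hθle.trans (by nlinarith))
    refine (mean_mono fun c => ?_).trans (this.trans ?_)
    · rw [Nenum_coe]
    have h3 : (3 : ℝ) ≤ Real.exp (g / 1024) := by
      have := Real.add_one_le_exp (g / 1024)
      linarith
    calc 3 * Real.exp (-(u / 512)) ≤ Real.exp (g / 1024) * Real.exp (-(g / 512)) := by
          gcongr
      _ = _ := by rw [← Real.exp_add]; congr 1; ring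
  · refine (mean_mono (G := fun c : Fin M → _ =>
      if pairCount (linked n Q P) c = 0 then (1 : ℝ) else 0) fun c => ?_).trans ?_
    · rw [Nenum_coe]
      split_ifs with h1 h2 h2
      · exact le_rfl
      · have : (1 : ℝ) ≤ pairCount (linked n Q P) c := by
          exact_mod_cast Nat.one_le_iff_ne_zero.mpr h2
        linarith
      · exact zero_le_one
      · exact le_rfl
    set p := mean (conflict n Q d Δ) fun c : Fin M → _ =>
      if pairCount (linked n Q P) c = 0 then (1 : ℝ) else 0
    have h1 : p ≤ 1 - g / 1024 := by
      have hu0 : 0 < u := by positivity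
      refine le_of_mul_le_mul_right (hzero.trans ?_) (by positivity : 0 < 1 + u / 256)
      nlinarith [mul_le_mul_of_nonneg_right hg' hu0.le]
    have := Real.add_one_le_exp (-(g / 1024))
    linarith

lemma exp_le_Mof (R : ℝ) (n : ℕ) : Real.exp (n * R) ≤ Mof R n := Nat.le_ceil _

lemma Mof_le {R : ℝ} (hR : 0 < R) (n : ℕ) : (Mof R n : ℝ) ≤ 2 * Real.exp (n * R) := by
  have h1 := Nat.ceil_lt_add_one (Real.exp_pos (n * R)).le
  have h2 : (1 : ℝ) ≤ Real.exp (n * R) := Real.one_le_exp (by positivity)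
  unfold Mof
  linarith

/-- Doubly exponential bound on the lower tail of the type enumerator of one joint type. -/
theorem eventually_prob_Nenum_le (hd : IsDistance d) (hP : Joint Q P) (hΔ : Δ < d P)
    {R δ ε : ℝ} (hR : 0 < R) (hδ : 0 < δ) (hε : 0 < ε)
    (hI : ∀ P', Joint Q P' → d P' ≤ Δ → R + 2 * δ ≤ mutInf P') :
    ∀ᶠ n : ℕ in atTop, IsTypeDist n P →
      prob n Q d Δ (Mof R n) (fun c => (Nenum n P c : ℝ) ≤ Real.exp (-(n * ε)) *
        expect n Q d Δ (Mof R n) fun c' => (Nenum n P c' : ℝ)) ≤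
      Real.exp (-(Real.exp (n * min R (2 * R - mutInf P)) /
        (17 * ((n : ℝ) + 1) ^ Fintype.card (α × α)) / 1024)) := by
  set m := min R (2 * R - mutInf P) with hm
  set C := Fintype.card (α × α)
  have hmR : m ≤ R := min_le_left _ _
  have hmI : m ≤ 2 * R - mutInf P := min_le_right _ _
  have hcase : ∀ᶠ n : ℕ in atTop, 0 < m → 34816 * ((n : ℝ) + 1) ^ C ≤ Real.exp (n * m) := by
    by_cases h : 0 < m
    · filter_upwards [eventually_poly_mul_exp_le_one 34816 C h] with n hn _
      rwa [Real.exp_neg, ← div_eq_mul_inv, div_le_one (Real.exp_pos _)] at hn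
    · exact Eventually.of_forall fun _ h' => absurd h' h
  filter_upwards [eventually_gt_atTop 0, hcase,
    eventually_poly_mul_exp_le_one 1024 (2 * Fintype.card α + C) (c := 2 * δ) (by positivity),
    eventually_poly_mul_exp_le_one 32 0 hR, eventually_poly_mul_exp_le_one 1024 0 hε,
    eventually_poly_mul_exp_le_one 16 (2 * Fintype.card α) hε] with n hn hc hball h32 hs hs' ht
  have hMlow := exp_le_Mof R n
  have hMup := Mof_le hR n
  have hM32 : 32 ≤ Mof R n := by
    rw [pow_zero, mul_one, Real.exp_neg, ← div_eq_mul_inv, div_le_one (Real.exp_pos _)] at h32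
    exact_mod_cast h32.trans hMlow
  have hconf : ∀ x ∈ typeClass n Q,
      512 * Mof R n * ((typeClass n Q).filter fun z => d (emp2 n z x) ≤ Δ).card ≤
        (typeClass n Q).card := by
    intro x hx
    have h1 := card_conflict_le hn hI hx
    have h2 : (512 * Mof R n * ((typeClass n Q).filter fun z => d (emp2 n z x) ≤ Δ).card : ℝ) ≤
        (typeClass n Q).card := by
      calc _ ≤ 512 * (2 * Real.exp (n * R)) * (((n : ℝ) + 1) ^ (2 * Fintype.card α + C) *
            Real.exp (-(n * (R + 2 * δ))) * (typeClass n Q).card) := by gcongr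
        _ = (1024 * ((n : ℝ) + 1) ^ (2 * Fintype.card α + C) * (Real.exp (n * R) *
            Real.exp (-(n * (R + 2 * δ))))) * (typeClass n Q).card := by ring
        _ = (1024 * ((n : ℝ) + 1) ^ (2 * Fintype.card α + C) * Real.exp (-(n * (2 * δ)))) *
            (typeClass n Q).card := by
          rw [← Real.exp_add]
          congr 3
          ring
        _ ≤ 1 * (typeClass n Q).card := by gcongr
        _ = _ := one_mul _
    exact_mod_cast h2
  obtain ⟨a, L, hreg, ha, hL⟩ := exists_regular hn hd hP ht hΔ (by omega) hconf
  have hτ : (0 : ℝ) < (typeClass n Q).card := by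
    exact_mod_cast card_pos.mpr
      (typeClass_nonempty hn hP.isDist_marginal (hP.isTypeDist_marginal ht))
  have hup := hP.degree_le hn ht ha
  have hlow := hP.le_degree hn ht ha
  rw [← div_le_iff₀ hτ] at hup
  rw [← le_div_iff₀ hτ, mul_div_assoc] at hlow
  set q : ℝ := (a : ℝ) / (typeClass n Q).card
  have hq0 : 0 ≤ q := by positivity
  have hpoly : (1 : ℝ) ≤ ((n : ℝ) + 1) ^ C := one_le_pow₀ (by linarith [Nat.cast_nonneg (α := ℝ) n])
  have h17 : 17 * (Real.exp (n * m) / (17 * ((n : ℝ) + 1) ^ C)) =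
      Real.exp (n * m) / ((n : ℝ) + 1) ^ C := by field_simp
  refine prob_Nenum_le hreg hM32 hL (Real.exp_pos _).le (by positivity) ?_ ?_ ?_
  · rw [h17]
    refine (div_le_self (Real.exp_pos _).le hpoly).trans (le_trans ?_ hMlow)
    gcongr
  · rw [h17, div_le_iff₀ (by positivity)]
    calc Real.exp (n * m) ≤ Real.exp (n * (2 * R - mutInf P)) := by gcongr
      _ = Real.exp (n * R) ^ 2 * Real.exp (-(n * mutInf P)) := by
        rw [← Real.exp_nat_mul, ← Real.exp_add]
        congr 1
        push_cast
        ring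
      _ ≤ (Mof R n : ℝ) ^ 2 * (((n : ℝ) + 1) ^ C * q) := by gcongr
      _ = _ := by ring
  · by_cases h : 0 < m
    · left
      refine ⟨by simpa using hs, ?_⟩
      rw [le_div_iff₀ (by positivity)]
      linarith [hc h]
    · right
      have hI2 : 2 * R - mutInf P ≤ 0 := by
        rcases min_choice R (2 * R - mutInf P) with h' | h'
        · rw [← hm] at h'
          exact absurd (h' ▸ hR) h
        · rw [← h', ← hm]
          exact not_lt.mp h
      constructor
      · have h4 : (Mof R n : ℝ) ^ 2 * q ≤ 4 * ((n : ℝ) + 1) ^ (2 * Fintype.card α) := by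
          calc _ ≤ (2 * Real.exp (n * R)) ^ 2 * (((n : ℝ) + 1) ^ (2 * Fintype.card α) *
                Real.exp (-(n * mutInf P))) := by gcongr
            _ = 4 * ((n : ℝ) + 1) ^ (2 * Fintype.card α) *
                Real.exp (n * (2 * R - mutInf P)) := by
              have : Real.exp (n * (2 * R - mutInf P)) =
                  Real.exp (n * R) ^ 2 * Real.exp (-(n * mutInf P)) := by
                rw [← Real.exp_nat_mul, ← Real.exp_add]
                congr 1
                push_cast
                ring
              rw [this]
              ring
            _ ≤ 4 * ((n : ℝ) + 1) ^ (2 * Fintype.card α) * 1 := by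
              gcongr
              exact Real.exp_le_one_iff.mpr (mul_nonpos_of_nonneg_of_nonpos (by positivity) hI2)
            _ = _ := mul_one _
        have h5 := mul_le_mul_of_nonneg_left h4 (by positivity : 0 ≤ 2 * Real.exp (-(n * ε)))
        linarith
      · rw [div_le_one (by positivity)]
        have : Real.exp (n * m) ≤ 1 := Real.exp_le_one_iff.mpr
          (mul_nonpos_of_nonneg_of_nonpos (by positivity) (not_lt.mp h))
        linarith

end Ensemble

section Asymptotics

lemma finite_of_isTypeDist {γ : Type} [Fintype γ] {D : ℕ} (hD : 0 < D) {𝒟 : Set (γ → ℝ)}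
    (hdist : ∀ P ∈ 𝒟, IsDist P) (htype : ∀ P ∈ 𝒟, IsTypeDist D P) : 𝒟.Finite := by
  have hD' : (0 : ℝ) < D := by exact_mod_cast hD
  refine (Set.finite_range fun (k : γ → Fin (D + 1)) (b : γ) => ((k b : ℕ) : ℝ) / D).subset ?_
  intro P hP
  obtain ⟨k, hk, hsum⟩ := exists_counts (hdist P hP) (htype P hP)
  refine ⟨fun b => ⟨k b, Nat.lt_succ_of_le ?_⟩, funext fun b => ?_⟩
  · rw [← hsum]
    exact single_le_sum (fun _ _ => Nat.zero_le _) (mem_univ b)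
  · simp only
    rw [← hk b, mul_div_assoc, div_self hD'.ne', mul_one]

lemma IsTypeDist.nseq {γ : Type} {D : ℕ} {P : γ → ℝ} (h : IsTypeDist D P) (t : ℕ) :
    IsTypeDist (nseq D t) P := by
  intro b
  obtain ⟨k, hk⟩ := h b
  refine ⟨k * (t + 1), ?_⟩
  rw [RGV.nseq]
  push_cast
  rw [← mul_assoc, hk]

lemma tendsto_nseq {D : ℕ} (hD : 0 < D) : Tendsto (nseq D) atTop atTop :=
  tendsto_atTop_mono (fun t => (Nat.le_succ t).trans (Nat.le_mul_of_pos_left _ hD)) tendsto_id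

lemma le_drate {n : ℕ} (hn : 0 < n) {p r : ℝ} (h : p ≤ Real.exp (-Real.exp (n * r))) :
    (r : EReal) ≤ drate n p := by
  have hn' : (0 : ℝ) < n := by exact_mod_cast hn
  unfold drate
  split_ifs with h0 h1
  · exact le_top
  · have : Real.exp (-Real.exp (n * r)) < 1 := by
      rw [Real.exp_lt_one_iff]
      exact neg_lt_zero.mpr (Real.exp_pos _)
    linarith
  · rw [EReal.coe_le_coe_iff, le_div_iff₀ hn', mul_comm]
    have hlog : Real.exp (n * r) ≤ -Real.log p := by
      have := Real.log_le_log (not_le.mp h0) h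
      rw [Real.log_exp] at this
      linarith
    exact (Real.le_log_iff_exp_le ((Real.exp_pos _).trans_le hlog)).mpr hlog

lemma add_le_of_le_sInf_sub {γ : Type} {f : γ → ℝ} {s : Set γ} {R δ : ℝ} {v : EReal}
    (hv : v ≤ sInf ((fun P => ((f P : ℝ) : EReal)) '' s))
    (h : (R : EReal) ≤ v - ((2 * δ : ℝ) : EReal)) {P : γ} (hP : P ∈ s) : R + 2 * δ ≤ f P := by
  have h1 : v ≤ ((f P : ℝ) : EReal) := hv.trans (sInf_le ⟨P, hP, rfl⟩)
  have h2 := h.trans (EReal.sub_le_sub h1 le_rfl)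
  rw [← EReal.coe_sub, EReal.coe_le_coe_iff] at h2
  linarith

end Asymptotics

end RGV

open RGV in
/-- Double-exponential bound on the probability that the type
enumerator is much below its mean, uniformly over a family `𝒟` of joint types, under
condition (B) or condition (C). -/
theorem statement16 {α : Type} [Fintype α] [Nonempty α]
    (Q : α → ℝ) (D : ℕ) (hD : 0 < D) (hQ : IsDist Q) (hQD : IsTypeDist D Q)
    (d : (α × α → ℝ) → ℝ) (hd : IsDistance d) (Δ : ℝ)
    (R δ ε : ℝ) (hR : 0 < R) (hδ : 0 < δ) (hε : 0 < ε)
    (𝒟 : Set (α × α → ℝ)) (h𝒟ne : 𝒟.Nonempty)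
    (h𝒟 : ∀ P ∈ 𝒟, Joint Q P ∧ Δ < d P) (h𝒟D : ∀ P ∈ 𝒟, IsTypeDist D P)
    (hBC :
      (sInf ((fun P : α × α → ℝ => ((mutInf P : ℝ) : EReal)) '' 𝒟) -
            ((2 * δ : ℝ) : EReal) ≤ ((R : ℝ) : EReal) ∧
        ((R : ℝ) : EReal) ≤
          sInf ((fun P : α × α → ℝ => ((mutInf P : ℝ) : EReal)) ''
            { P : α × α → ℝ | Joint Q P ∧ d P ≤ Δ }) - ((2 * δ : ℝ) : EReal)) ∨
      ((R : ℝ) : EReal) ≤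
        min
          (sInf ((fun P : α × α → ℝ => ((mutInf P : ℝ) : EReal)) '' 𝒟) -
            sInf ((fun P : α × α → ℝ => ((mutInf P : ℝ) : EReal)) ''
              { P : α × α → ℝ | Joint Q P ∧ d P ≤ Δ }))
          (sInf ((fun P : α × α → ℝ => ((mutInf P : ℝ) : EReal)) ''
            { P : α × α → ℝ | Joint Q P ∧ d P ≤ Δ })) - ((2 * δ : ℝ) : EReal)) :
    min (((R - 2 * δ : ℝ)) : EReal)
        (((2 * R : ℝ) : EReal) -
          sInf ((fun P : α × α → ℝ => ((mutInf P : ℝ) : EReal)) '' 𝒟)) ≤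
      Filter.liminf
        (fun t : ℕ => drate (nseq D t)
          (sInf ((fun P : α × α → ℝ =>
            prob (nseq D t) Q d Δ (Mof R (nseq D t))
              (fun c => ((Nenum (nseq D t) P c : ℕ) : ℝ) ≤
                Real.exp (-((nseq D t : ℝ) * ε)) *
                  expect (nseq D t) Q d Δ (Mof R (nseq D t))
                    (fun c' => ((Nenum (nseq D t) P c' : ℕ) : ℝ)))) '' 𝒟)))
        Filter.atTop := by
  have hI : ∀ P', Joint Q P' → d P' ≤ Δ → R + 2 * δ ≤ mutInf P' := fun P' hJ hle => by
    rcases hBC with ⟨-, h⟩ | h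
    · exact add_le_of_le_sInf_sub le_rfl h ⟨hJ, hle⟩
    · exact add_le_of_le_sInf_sub (min_le_right _ _) h ⟨hJ, hle⟩
  obtain ⟨P, hP, hmin⟩ := (finite_of_isTypeDist hD (fun P hP => (h𝒟 P hP).1.1) h𝒟D).exists_minimalFor
    mutInf 𝒟 h𝒟ne
  have hmin' : ∀ P' ∈ 𝒟, mutInf P ≤ mutInf P' := fun P' hP' =>
    (le_total (mutInf P) (mutInf P')).elim id (hmin hP')
  have hinf : sInf ((fun P : α × α → ℝ => ((mutInf P : ℝ) : EReal)) '' 𝒟) =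
      ((mutInf P : ℝ) : EReal) :=
    IsLeast.csInf_eq ⟨⟨P, hP, rfl⟩, by
      rintro _ ⟨P', hP', rfl⟩
      exact EReal.coe_le_coe_iff.mpr (hmin' P' hP')⟩
  rw [hinf, ← EReal.coe_sub]
  have hle : min ((R - 2 * δ : ℝ) : EReal) ((2 * R - mutInf P : ℝ) : EReal) ≤
      ((min R (2 * R - mutInf P) : ℝ) : EReal) := by
    rw [EReal.coe_strictMono.monotone.map_min]
    exact min_le_min_right _ (EReal.coe_le_coe_iff.mpr (by linarith))
  refine hle.trans (EReal.ge_of_forall_gt_iff_ge.mp fun r hr => ?_)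
  set m := min R (2 * R - mutInf P)
  have hr' : 0 < m - r := sub_pos.mpr (EReal.coe_lt_coe_iff.mp hr)
  refine le_liminf_of_le (by isBoundedDefault) ?_
  filter_upwards [(tendsto_nseq hD).eventually
      (eventually_prob_Nenum_le hd (h𝒟 P hP).1 (h𝒟 P hP).2 hR hδ hε hI),
    (tendsto_nseq hD).eventually (eventually_poly_mul_exp_le_one (17 * 1024)
      (Fintype.card (α × α)) hr'),
    (tendsto_nseq hD).eventually (eventually_gt_atTop 0)] with t ht hpoly hpos
  refine le_drate hpos ?_
  refine (csInf_le ⟨0, ?_⟩ (Set.mem_image_of_mem _ hP)).trans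
    ((ht ((h𝒟D P hP).nseq t)).trans (Real.exp_le_exp.mpr (neg_le_neg ?_)))
  · rintro _ ⟨P', -, rfl⟩
    exact prob_nonneg _
  · rw [div_div, le_div_iff₀ (by positivity)]
    have hexp : Real.exp (nseq D t * r) =
        Real.exp (nseq D t * m) * Real.exp (-(nseq D t * (m - r))) := by
      rw [← Real.exp_add]
      congr 1
      ring
    rw [hexp]
    have := mul_le_mul_of_nonneg_left hpoly (Real.exp_pos (nseq D t * m)).le
    linarith
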